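/- Let (D_n)_{n ∈ ℕ} be a sequence of pairwise disjoint Jordan regions in the unit sphere S² ⊆ ℝ³ that forms a null family and whose union is dense in S², and let 𝒮 = S² \ ⋃_n int(D_n), where int denotes interior in the subspace topology of S² (by Whyburn's characterization, 𝒮 is a planar Sierpiński carpet whose peripheral circles are exactly the frontiers ∂D_n). Let n₁, …, n_k be k distinct indices and let p_j ∈ ∂D_{n_j} for j = 1, …, k. Then there exists a topological embedding h : E_k → 𝒮 such that h(q_j) = p_j for each j ∈ {1, …, k}, and such that the image h(E_k) intersects the union ⋃_n ∂D_n of all the frontiers precisely in the set {p₁, …, p_k}. -/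

import Mathlib

open Metric Set

/-- The point `(x, y)` of the Euclidean plane. -/
noncomputable def pt2 (x y : ℝ) : EuclideanSpace ℝ (Fin 2) :=
  (WithLp.equiv 2 (Fin 2 → ℝ)).symm ![x, y]

/-- The `j`-th endpoint `q_j = (cos (2πj/k), sin (2πj/k))` of the standard `k`-pointed star. -/
noncomputable def starVertex (k j : ℕ) : EuclideanSpace ℝ (Fin 2) :=
  pt2 (Real.cos (2 * Real.pi * j / k)) (Real.sin (2 * Real.pi * j / k))

/-- The standard `k`-pointed star `E_k ⊆ ℝ²`: the union of the closed segments from the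
origin to the points `q_j`, `j = 1, …, k`. -/
noncomputable def starSet (k : ℕ) : Set (EuclideanSpace ℝ (Fin 2)) :=
  ⋃ j ∈ Finset.Icc 1 k, segment ℝ 0 (starVertex k j)

/-- The unit sphere `S² ⊆ ℝ³`, as a topological (metric) space. -/
abbrev Sphere2 : Type := ↥(Metric.sphere (0 : EuclideanSpace ℝ (Fin 3)) 1)

/-- A Jordan region in `S²`: the image of a topological embedding of the closed unit disc
of `ℝ²` which carries the unit circle onto the frontier of the image. -/
def IsJordanRegion (D : Set Sphere2) : Prop :=
  ∃ f : EuclideanSpace ℝ (Fin 2) → Sphere2,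
    Topology.IsEmbedding ((Metric.closedBall (0 : EuclideanSpace ℝ (Fin 2)) 1).restrict f) ∧
    f '' Metric.closedBall (0 : EuclideanSpace ℝ (Fin 2)) 1 = D ∧
    f '' Metric.sphere (0 : EuclideanSpace ℝ (Fin 2)) 1 = frontier D

open Topology

/-- Every zero-free continuous complex function on `K` has a continuous logarithm. -/
def HasContLogs {X : Type*} [TopologicalSpace X] (K : Set X) : Prop :=
  ∀ f : X → ℂ, ContinuousOn f K → (∀ x ∈ K, f x ≠ 0) →
    ∃ g : X → ℂ, ContinuousOn g K ∧ ∀ x ∈ K, Complex.exp (g x) = f x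

theorem exists_log_of_contractibleSpace {A : Type*} [TopologicalSpace A] [ContractibleSpace A]
    (f : C(A, ℂ)) (hf : ∀ a, f a ≠ 0) : ∃ g : C(A, ℂ), ∀ a, Complex.exp (g a) = f a := by
  obtain ⟨y, ⟨H⟩⟩ := id_nullhomotopic A
  let f' : C(A, {z : ℂ // z ≠ 0}) := ⟨fun a => ⟨f a, hf a⟩, by fun_prop⟩
  let Φ : C(unitInterval × A, {z : ℂ // z ≠ 0}) := f'.comp H.symm.toContinuousMap
  have h0 : ∀ a, Φ (0, a) =
      (⟨Complex.exp ((ContinuousMap.const A (Complex.log (f y))) a), Complex.exp_ne_zero _⟩ :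
        {z : ℂ // z ≠ 0}) := by
    intro a
    apply Subtype.ext
    have : H.symm (0, a) = y := by simp
    change f (H.symm (0, a)) = _
    simp [Complex.exp_log (hf y)]
  let G := Complex.isCoveringMap_exp.liftHomotopy Φ _ h0
  refine ⟨⟨fun a => G (1, a), by fun_prop⟩, fun a => ?_⟩
  have := congrFun (Complex.isCoveringMap_exp.liftHomotopy_lifts Φ _ h0) (1, a)
  have h2 := congrArg Subtype.val this
  change Complex.exp (G (1, a)) = f (H.symm (1, a)) at h2
  simpa using h2

theorem hasContLogs_image {E X : Type*} [TopologicalSpace E] [TopologicalSpace X] {s : Set E}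
    [ContractibleSpace s] {h : E → X} (hh : IsEmbedding (s.domRestrict h)) :
    HasContLogs (h '' s) := by
  intro f hf hf0
  have hc : Continuous fun a : s => f (h a) :=
    hf.comp_continuous hh.continuous fun a => mem_image_of_mem h a.2
  obtain ⟨g, hg⟩ := exists_log_of_contractibleSpace ⟨_, hc⟩ fun a => hf0 _ (mem_image_of_mem h a.2)
  refine ⟨Function.extend (s.domRestrict h) g 0, ?_, ?_⟩
  · have : h '' s = range (s.domRestrict h) := by rw [range_domRestrict]
    rw [this, continuousOn_iff_continuous_domRestrict]
    rw [← hh.toHomeomorph.comp_continuous_iff']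
    convert g.continuous using 1
    ext a
    exact hh.injective.extend_apply g 0 a
  · rintro _ ⟨a, ha, rfl⟩
    have := hh.injective.extend_apply g 0 ⟨a, ha⟩
    simp only [domRestrict_apply] at this
    rw [this]
    exact hg ⟨a, ha⟩

theorem hasContLogs_singleton {X : Type*} [TopologicalSpace X] (c : X) :
    HasContLogs ({c} : Set X) := fun f _ hf =>
  ⟨fun _ => Complex.log (f c), continuousOn_const, by
    rintro x rfl
    exact Complex.exp_log (hf x rfl)⟩

theorem exists_int_of_exp_eq_one {X : Type*} [TopologicalSpace X] {S : Set X}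
    (hS : IsPreconnected S) {g : X → ℂ} (hg : ContinuousOn g S)
    (h : ∀ x ∈ S, Complex.exp (g x) = 1) :
    ∃ d : ℤ, ∀ x ∈ S, g x = d * (2 * Real.pi * Complex.I) := by
  rcases S.eq_empty_or_nonempty with rfl | ⟨s, hs⟩
  · exact ⟨0, by simp⟩
  obtain ⟨d, hd⟩ := Complex.exp_eq_one_iff.1 (h s hs)
  refine ⟨d, fun x hx => ?_⟩
  have := Complex.isCoveringMap_exp.eqOn_of_comp_eqOn hS hg (continuousOn_const (c := g s))
    (fun y hy => Subtype.ext ((h y hy).trans (h s hs).symm)) hs rfl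
  rw [this hx, hd]

theorem HasContLogs.union {X : Type*} [TopologicalSpace X] {A B : Set X} (hA : HasContLogs A)
    (hB : HasContLogs B) (cA : IsClosed A) (cB : IsClosed B) (hAB : IsPreconnected (A ∩ B)) :
    HasContLogs (A ∪ B) := by
  classical
  intro f hf hf0
  obtain ⟨u, hu, hu'⟩ := hA f (hf.mono subset_union_left) fun x hx => hf0 x (.inl hx)
  obtain ⟨w, hw, hw'⟩ := hB f (hf.mono subset_union_right) fun x hx => hf0 x (.inr hx)
  obtain ⟨d, hd⟩ := exists_int_of_exp_eq_one hAB
    ((hu.mono inter_subset_left).sub (hw.mono inter_subset_right)) (fun x hx => by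
      simp only [Pi.sub_apply]
      rw [Complex.exp_sub, hu' x hx.1, hw' x hx.2, div_self (hf0 x (.inl hx.1))])
  let g : X → ℂ := fun x => if x ∈ A then u x else w x + d * (2 * Real.pi * Complex.I)
  have gA : ∀ x ∈ A, g x = u x := fun x hx => if_pos hx
  have gB : ∀ x ∈ B, g x = w x + d * (2 * Real.pi * Complex.I) := by
    intro x hx
    by_cases hxA : x ∈ A
    · rw [gA x hxA, ← hd x ⟨hxA, hx⟩]; simp
    · exact if_neg hxA
  refine ⟨g, ContinuousOn.union_of_isClosed (hu.congr gA)
    ((hw.add continuousOn_const).congr gB) cA cB, ?_⟩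
  rintro x (hx | hx)
  · rw [gA x hx, hu' x hx]
  · rw [gB x hx, Complex.exp_add, hw' x hx, Complex.exp_int_mul_two_pi_mul_I, mul_one]

theorem eq_zero_of_exp_eq_zpow_on_sphere {a : ℂ} {n : ℤ} {R : ℝ} (hR : 0 < R) {l : ℂ → ℂ}
    (hl : ContinuousOn l (sphere a R)) (h : ∀ z ∈ sphere a R, Complex.exp (l z) = (z - a) ^ n) :
    n = 0 := by
  have hm : ∀ t : ℝ, circleMap a R t ∈ sphere a R := fun t => circleMap_mem_sphere a hR.le t
  have hc : Continuous fun t : ℝ => l (circleMap a R t) - (n * Real.log R + n * (t * Complex.I)) :=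
    (hl.comp_continuous (continuous_circleMap a R) hm).sub (by fun_prop)
  obtain ⟨d, hd⟩ := exists_int_of_exp_eq_one (S := univ) isPreconnected_univ hc.continuousOn
    (fun t _ => by
      rw [Complex.exp_sub, h _ (hm t), Complex.exp_add, Complex.exp_int_mul, Complex.exp_int_mul,
        ← Complex.ofReal_exp, Real.exp_log hR, circleMap_sub_center, circleMap, zero_add, mul_zpow,
        div_self]
      exact mul_ne_zero (zpow_ne_zero _ (by exact_mod_cast hR.ne'))
        (zpow_ne_zero _ (Complex.exp_ne_zero _)))
  have h0 := hd 0 trivial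
  have h1 := hd (2 * Real.pi) trivial
  have hper : circleMap a R (2 * Real.pi) = circleMap a R 0 := by
    simpa using periodic_circleMap a R 0
  rw [← h0] at h1
  simp only [hper] at h1
  push_cast at h1
  have h2 : (n : ℂ) * (2 * Real.pi * Complex.I) = 0 := by linear_combination -h1
  simpa [Real.pi_ne_zero] using h2

theorem eq_zero_of_exp_eq_zpow_mul {K U : Set ℂ} (hK : IsClosed K) (hU : IsOpen U)
    (hUb : Bornology.IsBounded U) (hfr : frontier U ⊆ K) {a : ℂ} (ha : a ∈ U) {n : ℤ}
    {r g : ℂ → ℂ} (hr : ContinuousOn r (U ∪ K)) (hr0 : ∀ z ∈ U ∪ K, r z ≠ 0)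
    (hg : ContinuousOn g K) (h : ∀ z ∈ K, Complex.exp (g z) = (z - a) ^ n * r z) : n = 0 := by
  classical
  obtain ⟨G, hG⟩ := ContinuousMap.exists_restrict_eq (Y := ℂ) hK
    ⟨K.domRestrict g, continuousOn_iff_continuous_domRestrict.1 hg⟩
  have hG' : ∀ z ∈ K, G z = g z := fun z hz => DFunLike.congr_fun hG ⟨z, hz⟩
  let F : ℂ → ℂ := fun z => if z ∈ U then r z else Complex.exp (G z) * ((z - a) ^ n)⁻¹
  have hcl : closure U ⊆ U ∪ K := by
    rw [closure_eq_self_union_frontier]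
    exact union_subset_union_right _ hfr
  have hza : ∀ z ∉ U, z - a ≠ 0 := fun z hz h0 => hz (by rwa [sub_eq_zero.1 h0])
  have F1 : ∀ z ∈ closure U, F z = r z := by
    intro z hz
    by_cases hzU : z ∈ U
    · exact if_pos hzU
    · have hzK : z ∈ K := (hcl hz).resolve_left hzU
      simp only [F, if_neg hzU]
      rw [hG' z hzK, h z hzK, mul_comm, ← mul_assoc, inv_mul_cancel₀ (zpow_ne_zero _ (hza z hzU)),
        one_mul]
  have F2 : ∀ z ∈ Uᶜ, F z = Complex.exp (G z) * ((z - a) ^ n)⁻¹ := fun z hz => if_neg hz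
  have hF : Continuous F := by
    rw [← continuousOn_univ]
    have : (univ : Set ℂ) = closure U ∪ Uᶜ := by
      symm; rw [eq_univ_iff_forall]; intro z
      by_cases hz : z ∈ U
      · exact .inl (subset_closure hz)
      · exact .inr hz
    rw [this]
    refine ContinuousOn.union_of_isClosed ((hr.mono hcl).congr F1) (ContinuousOn.congr ?_ F2)
      isClosed_closure hU.isClosed_compl
    refine ContinuousOn.mul (by fun_prop) (ContinuousOn.inv₀ ?_ fun z hz =>
      zpow_ne_zero _ (hza z hz))
    exact ContinuousOn.zpow₀ (by fun_prop) n fun z hz => .inl (hza z hz)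
  have hF0 : ∀ z, F z ≠ 0 := by
    intro z
    by_cases hz : z ∈ U
    · rw [F1 z (subset_closure hz)]; exact hr0 z (.inl hz)
    · rw [F2 z hz]
      exact mul_ne_zero (Complex.exp_ne_zero _) (inv_ne_zero (zpow_ne_zero _ (hza z hz)))
  obtain ⟨L, hL⟩ := exists_log_of_contractibleSpace ⟨F, hF⟩ hF0
  obtain ⟨R, hR⟩ := hUb.subset_ball a
  have hRpos : 0 < R := by simpa using hR ha
  refine eq_zero_of_exp_eq_zpow_on_sphere (a := a) hRpos (l := fun z => G z - L z)
    (by fun_prop) fun z hz => ?_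
  have hzU : z ∉ U := fun hzU => by
    have := hR hzU
    rw [mem_ball] at this; rw [mem_sphere] at hz; exact this.ne hz
  rw [Complex.exp_sub, hL]
  change _ / F z = _
  rw [F2 z hzU]
  have := hza z hzU
  have h3 := zpow_ne_zero n this
  have h4 := Complex.exp_ne_zero (G z)
  field_simp

instance : LocallyConnectedSpace Sphere2 :=
  have : Fact (Module.finrank ℝ (EuclideanSpace ℝ (Fin 3)) = 2 + 1) := ⟨by simp⟩
  ChartedSpace.locallyConnectedSpace (EuclideanSpace ℝ (Fin 2)) Sphere2

instance : ConnectedSpace Sphere2 :=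
  Subtype.connectedSpace (isConnected_sphere (by
    rw [← Module.finrank_eq_rank, finrank_euclideanSpace_fin]; norm_num) 0 zero_le_one)

theorem exists_stereographic (v : Sphere2) : ∃ (φ : Sphere2 → ℂ) (ψ : ℂ → Sphere2),
    ContinuousOn φ {v}ᶜ ∧ Continuous ψ ∧ (∀ z, ψ z ≠ v) ∧ (∀ z, φ (ψ z) = z) ∧
      ∀ x, x ≠ v → ψ (φ x) = x := by
  have : Fact (Module.finrank ℝ (EuclideanSpace ℝ (Fin 3)) = 2 + 1) := ⟨by simp⟩
  let e := stereographic' 2 v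
  let L : EuclideanSpace ℝ (Fin 2) ≃L[ℝ] ℂ :=
    ContinuousLinearEquiv.ofFinrankEq (by simp [Complex.finrank_real_complex])
  have hs : e.source = {v}ᶜ := stereographic'_source v
  have ht : e.target = univ := stereographic'_target v
  refine ⟨fun x => L (e x), fun z => e.symm (L.symm z), ?_, ?_, fun z => ?_, fun z => ?_,
    fun x hx => ?_⟩
  · rw [← hs]
    exact L.continuous.comp_continuousOn e.continuousOn
  · have := e.continuousOn_symm
    rw [ht, continuousOn_univ] at this
    exact this.comp L.symm.continuous
  · have := e.map_target (x := L.symm z) (by simp [ht])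
    rw [hs] at this
    exact this
  · simp [e.right_inv (x := L.symm z) (by simp [ht])]
  · simp [e.left_inv (x := x) (by rw [hs]; exact hx)]

theorem exists_log_sub_of_norm_lt {X : Type*} [TopologicalSpace X] {K : Set X} {φ : X → ℂ}
    (hφ : ContinuousOn φ K) {a b : ℂ} (hab : ∀ z ∈ K, ‖a - b‖ < ‖φ z - a‖)
    (h : ∃ u : X → ℂ, ContinuousOn u K ∧ ∀ z ∈ K, Complex.exp (u z) = φ z - a) :
    ∃ u : X → ℂ, ContinuousOn u K ∧ ∀ z ∈ K, Complex.exp (u z) = φ z - b := by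
  obtain ⟨u, hu, hu'⟩ := h
  have h0 : ∀ z ∈ K, φ z - a ≠ 0 := fun z hz =>
    norm_pos_iff.1 ((norm_nonneg _).trans_lt (hab z hz))
  have hsl : ∀ z ∈ K, 1 + (a - b) / (φ z - a) ∈ Complex.slitPlane := fun z hz =>
    Complex.mem_slitPlane_of_norm_lt_one (by
      rw [norm_div, div_lt_one (norm_pos_iff.2 (h0 z hz))]; exact hab z hz)
  refine ⟨fun z => u z + Complex.log (1 + (a - b) / (φ z - a)), hu.add (ContinuousOn.clog ?_ hsl),
    fun z hz => ?_⟩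
  · exact continuousOn_const.add (continuousOn_const.div (hφ.sub continuousOn_const) h0)
  · have := h0 z hz
    rw [Complex.exp_add, hu' z hz, Complex.exp_log (Complex.slitPlane_ne_zero (hsl z hz))]
    field_simp
    ring

/-- The easy half of Eilenberg's criterion: in a stereographic chart centred at `v`, the function
`φ - φ x` has a logarithm on `K` if `K` does not separate `x` from `v`. -/
theorem exists_log_sub_of_mem_connectedComponentIn {v : Sphere2} {φ : Sphere2 → ℂ}
    {ψ : ℂ → Sphere2} (hφ : ContinuousOn φ {v}ᶜ) (hψ : Continuous ψ) (hv : ∀ z, ψ z ≠ v)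
    (hψφ : ∀ x, x ≠ v → ψ (φ x) = x) {K : Set Sphere2} (hK : IsClosed K)
    (hvK : v ∉ K) {x : Sphere2} (hx : x ∈ connectedComponentIn Kᶜ v) (hxv : x ≠ v) :
    ∃ u : Sphere2 → ℂ, ContinuousOn u K ∧ ∀ z ∈ K, Complex.exp (u z) = φ z - φ x := by
  have hφK : ContinuousOn φ K := hφ.mono fun z hz h => hvK (h ▸ hz)
  have hcpt : IsCompact (φ '' K) := hK.isCompact.image_of_continuousOn hφK
  let Q : Sphere2 → Prop := fun y => y = v ∨
    ∃ u : Sphere2 → ℂ, ContinuousOn u K ∧ ∀ z ∈ K, Complex.exp (u z) = φ z - φ y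
  suffices H : Q v → Q x from (H (.inl rfl)).resolve_left hxv
  refine isPreconnected_connectedComponentIn.induction₂' (fun a b => Q a → Q b) ?_
    (fun a b c _ _ _ h1 h2 h => h2 (h1 h)) (mem_connectedComponentIn hvK) hx
  intro y hy
  have hyK : y ∉ K := connectedComponentIn_subset _ _ hy
  refine Filter.Eventually.filter_mono nhdsWithin_le_nhds ?_
  by_cases hyv : y = v
  · subst hyv
    obtain ⟨M, hM⟩ := hcpt.isBounded.exists_norm_le
    have hM' : ∀ z ∈ K, ‖φ z‖ ≤ |M| := fun z hz => (hM _ (mem_image_of_mem φ hz)).trans (le_abs_self M)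
    have hC : IsClosed (ψ '' closedBall 0 |M|) :=
      ((isCompact_closedBall 0 |M|).image hψ).isClosed
    have hyC : y ∉ ψ '' closedBall 0 |M| := by rintro ⟨z, _, hz⟩; exact hv z hz
    filter_upwards [hC.isOpen_compl.mem_nhds hyC] with t ht
    refine ⟨fun _ => ?_, fun _ => .inl rfl⟩
    by_cases hty : t = y
    · exact .inl hty
    right
    have hbig : |M| < ‖φ t‖ := by
      by_contra! hle
      exact ht ⟨φ t, by simpa using hle, hψφ t hty⟩
    have hpos : φ t ≠ 0 := norm_pos_iff.1 ((abs_nonneg M).trans_lt hbig)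
    have hsl : ∀ z ∈ K, 1 + -(φ z / φ t) ∈ Complex.slitPlane := fun z hz =>
      Complex.mem_slitPlane_of_norm_lt_one (by
        rw [norm_neg, norm_div, div_lt_one (norm_pos_iff.2 hpos)]
        exact (hM' z hz).trans_lt hbig)
    refine ⟨fun z => Complex.log (-φ t) + Complex.log (1 + -(φ z / φ t)),
      continuousOn_const.add (ContinuousOn.clog ?_ hsl), fun z hz => ?_⟩
    · exact continuousOn_const.add (hφK.div_const _).neg
    · rw [Complex.exp_add, Complex.exp_log (neg_ne_zero.2 hpos),
        Complex.exp_log (Complex.slitPlane_ne_zero (hsl z hz))]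
      field_simp
      ring
  · have hφy : φ y ∉ φ '' K := by
      rintro ⟨z, hz, hzy⟩
      have hzv : z ≠ v := fun h => hvK (h ▸ hz)
      exact hyK (by rwa [← hψφ y hyv, ← hzy, hψφ z hzv])
    obtain ⟨δ, hδ, hδK⟩ := Metric.isOpen_iff.1 hcpt.isClosed.isOpen_compl _ hφy
    have hfar : ∀ z ∈ K, δ ≤ ‖φ z - φ y‖ := by
      intro z hz
      by_contra! hlt
      exact hδK (by rwa [mem_ball, dist_eq_norm]) (mem_image_of_mem φ hz)
    have hcy : ContinuousAt φ y := hφ.continuousAt (isOpen_compl_singleton.mem_nhds hyv)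
    filter_upwards [hcy.eventually (ball_mem_nhds _ (half_pos hδ)),
      isOpen_compl_singleton.mem_nhds hyv] with t ht htv
    rw [dist_eq_norm] at ht
    have ht' : ‖φ y - φ t‖ < δ / 2 := by rwa [norm_sub_rev]
    constructor
    · intro h
      refine .inr (exists_log_sub_of_norm_lt hφK (fun z hz => ?_) (h.resolve_left hyv))
      linarith [hfar z hz]
    · intro h
      refine .inr (exists_log_sub_of_norm_lt hφK (fun z hz => ?_) (h.resolve_left htv))
      have := norm_sub_le_norm_sub_add_norm_sub (φ z) (φ t) (φ y)
      linarith [hfar z hz]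

theorem exists_int_relation {k : ℕ} (d : Fin (k + 1) → Fin (k + 1) → ℤ) :
    ∃ (n : Fin (k + 1) → ℤ) (c : ℤ), (∃ i, n i ≠ 0) ∧ ∀ j, ∑ i, n i * d i j = c := by
  let w : Fin (k + 1) → Fin k → ℤ := fun i j => d i j.succ - d i 0
  have hw : ¬ LinearIndependent ℤ w := by
    intro h
    have := h.fintype_card_le_finrank
    simp at this
  obtain ⟨n, hn, hi⟩ := Fintype.not_linearIndependent_iff.1 hw
  refine ⟨n, ∑ i, n i * d i 0, hi, fun j => ?_⟩
  refine Fin.cases rfl (fun j => ?_) j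
  have := congrFun hn j
  simp only [w, Finset.sum_apply, Pi.smul_apply, smul_eq_mul, mul_sub, Finset.sum_sub_distrib,
    Pi.zero_apply] at this
  linarith

/-- The hard half of Eilenberg's criterion: if the points `x i` lie in distinct components of the
complement of `K`, a product of powers of the functions `φ - φ (x i)` has a logarithm on `K` only
if all exponents vanish. -/
theorem eq_zero_of_exp_eq_prod_zpow {m : ℕ} {K : Set Sphere2} (hKc : IsClosed K)
    {x : Fin (m + 1) → Sphere2} (hxK : ∀ i, x i ∈ Kᶜ)
    (hne : ∀ i j, i ≠ j → x j ∉ connectedComponentIn Kᶜ (x i)) {φ : Sphere2 → ℂ} {ψ : ℂ → Sphere2}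
    (hφ : ContinuousOn φ {x 0}ᶜ) (hψ : Continuous ψ) (hφψ : ∀ z, φ (ψ z) = z)
    (hψφ : ∀ y, y ≠ x 0 → ψ (φ y) = y) {n : Fin m → ℤ} {g : Sphere2 → ℂ} (hg : ContinuousOn g K)
    (hge : ∀ z ∈ K, Complex.exp (g z) = ∏ i, (φ z - φ (x i.succ)) ^ n i) (i₀ : Fin m) :
    n i₀ = 0 := by
  classical
  have hKv : K ⊆ {x 0}ᶜ := fun z hz h => hxK 0 (h ▸ hz)
  have hs0 : ∀ i : Fin m, x i.succ ≠ x 0 := fun i h =>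
    hne _ _ (Fin.succ_ne_zero i) (h ▸ mem_connectedComponentIn (hxK i.succ))
  let C : Fin (m + 1) → Set Sphere2 := fun i => connectedComponentIn Kᶜ (x i)
  have hCo : ∀ i, IsOpen (C i) := fun i => hKc.isOpen_compl.connectedComponentIn
  have hxC : ∀ i, x i ∈ C i := fun i => mem_connectedComponentIn (hxK i)
  have hCd : ∀ i j, i ≠ j → Disjoint (C i) (C j) := by
    intro i j hij
    rw [Set.disjoint_left]
    intro z hzi hzj
    exact hne i j hij ((connectedComponentIn_eq hzi).trans (connectedComponentIn_eq hzj).symm ▸ hxC j)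
  have hψK : ∀ z, ψ z ∈ K ↔ z ∈ φ '' K := fun z =>
    ⟨fun h => ⟨_, h, hφψ z⟩, by rintro ⟨y, hy, rfl⟩; rwa [hψφ y (hKv hy)]⟩
  have hz0 : ∀ i, i ≠ i₀ → ∀ z ∈ ψ ⁻¹' C i₀.succ ∪ φ '' K, z - φ (x i.succ) ≠ 0 := by
    intro i hi z hz h0
    have hzx : ψ z = x i.succ := by rw [sub_eq_zero.1 h0, hψφ _ (hs0 i)]
    rcases hz with hz | hz
    · rw [mem_preimage, hzx] at hz
      exact Set.disjoint_left.1 (hCd _ _ fun h => hi (Fin.succ_injective _ h)) (hxC i.succ) hz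
    · rw [← hψK, hzx] at hz
      exact hxK _ hz
  refine (eq_zero_of_exp_eq_zpow_mul (K := φ '' K) (U := ψ ⁻¹' C i₀.succ)
    (a := φ (x i₀.succ)) (r := fun z => ∏ i ∈ Finset.univ.erase i₀, (z - φ (x i.succ)) ^ n i)
    (g := g ∘ ψ) ?_ ((hCo _).preimage hψ) ?_ ?_ ?_ ?_ ?_ ?_ ?_)
  · exact (hKc.isCompact.image_of_continuousOn (hφ.mono hKv)).isClosed
  · have : ψ ⁻¹' C i₀.succ ⊆ φ '' (C 0)ᶜ := fun z hz =>
      ⟨ψ z, Set.disjoint_left.1 (hCd _ _ (Fin.succ_ne_zero i₀)) hz, hφψ z⟩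
    refine Bornology.IsBounded.subset (IsCompact.isBounded ?_) this
    refine (hCo 0).isClosed_compl.isCompact.image_of_continuousOn (hφ.mono ?_)
    rintro z hz rfl
    exact hz (hxC 0)
  · intro z hz
    rw [← hψK]
    by_contra hzK
    have hcl : ψ z ∈ closure (C i₀.succ) :=
      closure_mono (image_preimage_subset _ _)
        (image_closure_subset_closure_image hψ ⟨z, hz.1, rfl⟩)
    have ho : IsOpen (connectedComponentIn Kᶜ (ψ z)) :=
      hKc.isOpen_compl.connectedComponentIn
    obtain ⟨y, hy1, hy2⟩ := mem_closure_iff.1 hcl _ ho (mem_connectedComponentIn hzK)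
    have heq := (connectedComponentIn_eq hy1).trans (connectedComponentIn_eq hy2).symm
    have hzU : z ∈ ψ ⁻¹' C i₀.succ := by
      change ψ z ∈ connectedComponentIn Kᶜ (x i₀.succ)
      rw [← heq]; exact mem_connectedComponentIn hzK
    exact hz.2 (by rwa [((hCo _).preimage hψ).interior_eq])
  · simpa [hψφ _ (hs0 i₀)] using hxC i₀.succ
  · refine continuousOn_finsetProd _ fun i hi => ?_
    refine ContinuousOn.zpow₀ (by fun_prop) _ fun z hz => ?_
    exact .inl (hz0 i (Finset.ne_of_mem_erase hi) z hz)
  · intro z hz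
    exact Finset.prod_ne_zero_iff.2 fun i hi =>
      zpow_ne_zero _ (hz0 i (Finset.ne_of_mem_erase hi) z hz)
  · refine hg.comp hψ.continuousOn fun z hz => (hψK z).2 hz
  · rintro _ ⟨z, hz, rfl⟩
    rw [Function.comp_apply, hψφ z (hKv hz), hge z hz,
      ← Finset.mul_prod_erase _ _ (Finset.mem_univ i₀)]


/-- A Janiszewski-type theorem: if `K₁ ∩ K₂` is a union of `k + 1` preconnected sets, points which
are separated neither by `K₁` nor by `K₂` lie in at most `k + 1` components of the complement
of `K₁ ∪ K₂`. -/
theorem exists_mem_connectedComponentIn_compl_union {k : ℕ} {K₁ K₂ : Set Sphere2}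
    (h₁ : IsClosed K₁) (h₂ : IsClosed K₂) {S : Fin (k + 1) → Set Sphere2}
    (hS : ∀ j, IsPreconnected (S j)) (hKS : K₁ ∩ K₂ = ⋃ j, S j) (x : Fin (k + 2) → Sphere2)
    (hx₁ : ∀ i, x i ∈ connectedComponentIn K₁ᶜ (x 0))
    (hx₂ : ∀ i, x i ∈ connectedComponentIn K₂ᶜ (x 0)) :
    ∃ i j, i ≠ j ∧ x j ∈ connectedComponentIn (K₁ ∪ K₂)ᶜ (x i) := by
  classical
  by_contra! hne
  have n₁ : ∀ i, x i ∉ K₁ := fun i => connectedComponentIn_subset _ _ (hx₁ i)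
  have n₂ : ∀ i, x i ∉ K₂ := fun i => connectedComponentIn_subset _ _ (hx₂ i)
  have hxK : ∀ i, x i ∈ (K₁ ∪ K₂)ᶜ := fun i h => h.elim (n₁ i) (n₂ i)
  have hxinj : ∀ i j, i ≠ j → x i ≠ x j := fun i j hij h =>
    hne i j hij (h ▸ mem_connectedComponentIn (hxK i))
  obtain ⟨φ, ψ, hφ, hψ, hv, hφψ, hψφ⟩ := exists_stereographic (x 0)
  have hs0 : ∀ i : Fin (k + 1), x i.succ ≠ x 0 := fun i => hxinj _ _ (Fin.succ_ne_zero i)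
  choose u hu hu' using fun i : Fin (k + 1) =>
    exists_log_sub_of_mem_connectedComponentIn hφ hψ hv hψφ h₁ (n₁ 0) (hx₁ i.succ) (hs0 i)
  choose w hw hw' using fun i : Fin (k + 1) =>
    exists_log_sub_of_mem_connectedComponentIn hφ hψ hv hψφ h₂ (n₂ 0) (hx₂ i.succ) (hs0 i)
  have hS₁ : ∀ j, S j ⊆ K₁ := fun j z hz => (hKS.symm.subset (mem_iUnion_of_mem j hz)).1
  have hS₂ : ∀ j, S j ⊆ K₂ := fun j z hz => (hKS.symm.subset (mem_iUnion_of_mem j hz)).2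
  choose d hd using fun i j => exists_int_of_exp_eq_one (hS j)
    (((hu i).mono (hS₁ j)).sub ((hw i).mono (hS₂ j))) (fun z hz => by
      simp only [Pi.sub_apply]
      rw [Complex.exp_sub, hu' i z (hS₁ j hz), hw' i z (hS₂ j hz), div_self]
      rw [← hu' i z (hS₁ j hz)]
      exact Complex.exp_ne_zero _)
  obtain ⟨n, c, ⟨i₀, hi₀⟩, hc⟩ := exists_int_relation d
  let g : Sphere2 → ℂ := fun z => if z ∈ K₁ then ∑ i, n i * u i z else
    ∑ i, n i * w i z + c * (2 * Real.pi * Complex.I)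
  have g₁ : ∀ z ∈ K₁, g z = ∑ i, n i * u i z := fun z hz => if_pos hz
  have g₂ : ∀ z ∈ K₂, g z = ∑ i, n i * w i z + c * (2 * Real.pi * Complex.I) := by
    intro z hz
    by_cases hz₁ : z ∈ K₁
    · rw [g₁ z hz₁]
      obtain ⟨j, hj⟩ := mem_iUnion.1 (hKS.subset ⟨hz₁, hz⟩)
      rw [← hc j]
      push_cast
      rw [Finset.sum_mul, ← Finset.sum_add_distrib]
      refine Finset.sum_congr rfl fun i _ => ?_
      have := hd i j z hj
      simp only [Pi.sub_apply] at this
      linear_combination (n i : ℂ) * this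
    · exact if_neg hz₁
  have hg : ContinuousOn g (K₁ ∪ K₂) := by
    refine ContinuousOn.union_of_isClosed (ContinuousOn.congr ?_ g₁) (ContinuousOn.congr ?_ g₂) h₁ h₂
    · exact continuousOn_finsetSum _ fun i _ => continuousOn_const.mul (hu i)
    · exact (continuousOn_finsetSum _ fun i _ => continuousOn_const.mul (hw i)).add
        continuousOn_const
  have hge : ∀ z ∈ K₁ ∪ K₂, Complex.exp (g z) = ∏ i, (φ z - φ (x i.succ)) ^ n i := by
    rintro z (hz | hz)
    · rw [g₁ z hz, Complex.exp_sum]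
      exact Finset.prod_congr rfl fun i _ => by rw [Complex.exp_int_mul, hu' i z hz]
    · rw [g₂ z hz, Complex.exp_add, Complex.exp_int_mul_two_pi_mul_I, mul_one, Complex.exp_sum]
      exact Finset.prod_congr rfl fun i _ => by rw [Complex.exp_int_mul, hw' i z hz]
  exact hi₀ (eq_zero_of_exp_eq_prod_zpow (h₁.union h₂) hxK hne hφ hψ hφψ hψφ hg hge i₀)

theorem mem_connectedComponentIn_compl_union {K₁ K₂ : Set Sphere2} (h₁ : IsClosed K₁)
    (h₂ : IsClosed K₂) (h : IsPreconnected (K₁ ∩ K₂)) {x y : Sphere2}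
    (hy₁ : y ∈ connectedComponentIn K₁ᶜ x) (hy₂ : y ∈ connectedComponentIn K₂ᶜ x) :
    y ∈ connectedComponentIn (K₁ ∪ K₂)ᶜ x := by
  have hx : ∀ {K : Set Sphere2}, y ∈ connectedComponentIn Kᶜ x →
      x ∈ connectedComponentIn Kᶜ x := fun hy =>
    mem_connectedComponentIn (connectedComponentIn_nonempty_iff.1 ⟨_, hy⟩)
  obtain ⟨i, j, hij, hm⟩ := exists_mem_connectedComponentIn_compl_union (k := 0) h₁ h₂
    (S := fun _ => K₁ ∩ K₂) (fun _ => h) (iUnion_const _).symm ![x, y]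
    (fun i => by fin_cases i <;> simp [hx hy₁, hy₁]) (fun i => by fin_cases i <;> simp [hx hy₂, hy₂])
  fin_cases i <;> fin_cases j <;> simp [-compl_union] at hij hm
  · exact hm
  · rw [← connectedComponentIn_eq hm]
    exact mem_connectedComponentIn (connectedComponentIn_nonempty_iff.1 ⟨_, hm⟩)

theorem HasContLogs.isPreconnected_compl {K : Set Sphere2} (hK : HasContLogs K)
    (hKc : IsClosed K) : IsPreconnected Kᶜ := by
  refine isPreconnected_of_forall_pair fun x hx y hy => ?_
  refine ⟨connectedComponentIn Kᶜ x, connectedComponentIn_subset _ _, mem_connectedComponentIn hx,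
    ?_, isPreconnected_connectedComponentIn⟩
  by_contra hxy
  obtain ⟨φ, ψ, hφ, hψ, hv, hφψ, hψφ⟩ := exists_stereographic x
  have hyx : y ≠ x := by
    rintro rfl
    exact hxy (mem_connectedComponentIn hx)
  obtain ⟨g, hg, hge⟩ := hK (fun z => φ z - φ y)
    ((hφ.mono fun z hz h => hx (h ▸ hz)).sub continuousOn_const) (fun z hz h => hy (by
      have : z ≠ x := fun h => hx (h ▸ hz)
      rw [← hψφ y hyx, ← sub_eq_zero.1 h, hψφ z this]; exact hz))
  have := eq_zero_of_exp_eq_prod_zpow (m := 1) hKc (x := ![x, y])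
    (fun i => by fin_cases i <;> simpa) (fun i j hij => by
      fin_cases i <;> fin_cases j <;> simp at hij ⊢
      · exact hxy
      · intro h
        exact hxy (connectedComponentIn_eq h ▸ mem_connectedComponentIn hy))
    (n := fun _ => 1) hφ hψ hφψ hψφ hg (by simpa using hge) 0
  exact one_ne_zero this

theorem isPreconnected_diff_of_hasContLogs {V A : Set Sphere2} (hV : IsPreconnected V)
    (hVo : IsOpen V) (hA : HasContLogs A) (hAc : IsClosed A) (hAV : A ⊆ V) :
    IsPreconnected (V \ A) := by
  refine isPreconnected_of_forall_pair fun x hx y hy => ?_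
  have hd : (Vᶜ ∪ A)ᶜ = V \ A := by rw [compl_union, compl_compl, sdiff_eq, inter_comm]
  have he : Vᶜ ∩ A = ∅ := by
    rw [← disjoint_iff_inter_eq_empty]; exact (disjoint_compl_left_iff_subset.2 hAV)
  refine ⟨connectedComponentIn (V \ A) x, connectedComponentIn_subset _ _,
    mem_connectedComponentIn hx, ?_, isPreconnected_connectedComponentIn⟩
  rw [← hd]
  refine mem_connectedComponentIn_compl_union hVo.isClosed_compl hAc
    (by rw [he]; exact isPreconnected_empty) ?_ ?_
  · rw [compl_compl, hV.connectedComponentIn hx.1]; exact hy.1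
  · rw [(hA.isPreconnected_compl hAc).connectedComponentIn hx.2]; exact hy.2

/-- A null sequence of pairwise disjoint, possibly empty, non-separating continua in the sphere. -/
structure IsNullFamily (E : ℕ → Set Sphere2) : Prop where
  isClosed : ∀ i, IsClosed (E i)
  isPreconnected : ∀ i, IsPreconnected (E i)
  hasContLogs : ∀ i, HasContLogs (E i)
  ne_univ : ∀ i, E i ≠ univ
  eq_of_mem : ∀ {i j x}, x ∈ E i → x ∈ E j → i = j
  finite : ∀ ε : ℝ, 0 < ε → {i | ε < diam (E i)}.Finite

/-- A set is saturated if it contains every member of the family that it meets. -/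
def IsSaturated (E : ℕ → Set Sphere2) (V : Set Sphere2) : Prop :=
  ∀ i, ∀ x ∈ E i, x ∈ V → E i ⊆ V

/-- The largest saturated subset of `O`. -/
def satCore (E : ℕ → Set Sphere2) (O : Set Sphere2) : Set Sphere2 :=
  {x ∈ O | ∀ i, x ∈ E i → E i ⊆ O}

theorem IsSaturated.inter {E : ℕ → Set Sphere2} {U V : Set Sphere2} (hU : IsSaturated E U)
    (hV : IsSaturated E V) : IsSaturated E (U ∩ V) := fun i x hi hx =>
  subset_inter (hU i x hi hx.1) (hV i x hi hx.2)

theorem satCore_subset (E : ℕ → Set Sphere2) (O : Set Sphere2) : satCore E O ⊆ O := fun _ h => h.1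

theorem mem_satCore_of_notMem {E : ℕ → Set Sphere2} {O : Set Sphere2} {x : Sphere2} (hx : x ∈ O)
    (h : ∀ i, x ∉ E i) : x ∈ satCore E O := ⟨hx, fun i hi => (h i hi).elim⟩

namespace IsNullFamily

variable {E : ℕ → Set Sphere2}

theorem mem_satCore (hE : IsNullFamily E) {O : Set Sphere2} {x : Sphere2} {i : ℕ} (hx : x ∈ E i)
    (h : E i ⊆ O) : x ∈ satCore E O :=
  ⟨h hx, fun _ hj => hE.eq_of_mem hx hj ▸ h⟩

theorem isSaturated_satCore (hE : IsNullFamily E) (O : Set Sphere2) :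
    IsSaturated E (satCore E O) :=
  fun i _ hi hx _ hy => hE.mem_satCore hy (hx.2 i hi)

theorem isOpen_satCore (hE : IsNullFamily E) {O : Set Sphere2} (hO : IsOpen O) :
    IsOpen (satCore E O) := by
  rw [isOpen_iff_mem_nhds]
  rintro x ⟨hx, hxE⟩
  obtain ⟨δ, hδ, hδO⟩ := Metric.isOpen_iff.1 hO x hx
  have h1 : ∀ᶠ y in 𝓝 x, ∀ i ∈ {i | δ / 2 < diam (E i)}, y ∈ E i → x ∈ E i := by
    rw [Filter.eventually_all_finite (hE.finite _ (half_pos hδ))]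
    intro i _
    by_cases hi : x ∈ E i
    · exact Filter.Eventually.of_forall fun _ _ => hi
    · filter_upwards [(hE.isClosed i).isOpen_compl.mem_nhds hi] with y hy hy' using (hy hy').elim
  filter_upwards [h1, ball_mem_nhds x (half_pos hδ), hO.mem_nhds hx] with y hy hyx hyO
  refine ⟨hyO, fun i hi => ?_⟩
  by_cases hiI : δ / 2 < diam (E i)
  · exact hxE i (hy i hiI hi)
  · intro z hz
    apply hδO
    have := dist_le_diam_of_mem (Bornology.IsBounded.all (E i)) hz hi
    rw [mem_ball] at hyx ⊢
    linarith [dist_triangle z y x]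

theorem isSaturated_compl (hE : IsNullFamily E) (i : ℕ) : IsSaturated E (E i)ᶜ :=
  fun _ _ hj hx _ hy hyi => hx (hE.eq_of_mem hy hyi ▸ hj)

theorem exists_closure_subset (hE : IsNullFamily E) {V : Set Sphere2} (hV : IsOpen V)
    (hs : IsSaturated E V) {x : Sphere2} (hx : x ∈ V) :
    ∃ V', IsOpen V' ∧ IsSaturated E V' ∧ x ∈ V' ∧ closure V' ⊆ V := by
  by_cases h : ∃ i, x ∈ E i
  · obtain ⟨i, hi⟩ := h
    obtain ⟨O, hO, hiO, hOV⟩ := normal_exists_closure_subset (hE.isClosed i) hV (hs i x hi hx)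
    exact ⟨_, hE.isOpen_satCore hO, hE.isSaturated_satCore O, hE.mem_satCore hi hiO,
      (closure_mono (satCore_subset E O)).trans hOV⟩
  · push Not at h
    obtain ⟨O, hO, hiO, hOV⟩ := normal_exists_closure_subset isClosed_singleton hV
      (singleton_subset_iff.2 hx)
    exact ⟨_, hE.isOpen_satCore hO, hE.isSaturated_satCore O,
      mem_satCore_of_notMem (singleton_subset_iff.1 hiO) h,
      (closure_mono (satCore_subset E O)).trans hOV⟩

/-- A Baire category argument for saturated open sets. -/
theorem exists_notMem (hE : IsNullFamily E) {W G : Set Sphere2} (hW : IsOpen W)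
    (hWs : IsSaturated E W) (hG : IsClosed G) (hne : (W ∩ G).Nonempty)
    (h : ∀ V ⊆ W, IsOpen V → IsSaturated E V → (V ∩ G).Nonempty → ∀ i, ∃ x ∈ V ∩ G, x ∉ E i) :
    ∃ x ∈ W ∩ G, ∀ i, x ∉ E i := by
  let T := {V : Set Sphere2 // V ⊆ W ∧ IsOpen V ∧ IsSaturated E V ∧ (V ∩ G).Nonempty}
  have step : ∀ (V : T) (i : ℕ), ∃ V' : T, closure V'.1 ⊆ V.1 \ E i := by
    rintro ⟨V, hVW, hVo, hVs, hVG⟩ i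
    obtain ⟨x, hx, hxi⟩ := h V hVW hVo hVs hVG i
    obtain ⟨V', h1, h2, h3, h4⟩ := hE.exists_closure_subset (hVo.inter (hE.isClosed i).isOpen_compl)
      (hVs.inter (hE.isSaturated_compl i)) ⟨hx.1, hxi⟩
    exact ⟨⟨V', subset_closure.trans (h4.trans (inter_subset_left.trans hVW)), h1, h2, x, h3, hx.2⟩,
      h4⟩
  choose F hF using step
  let V : ℕ → T := fun n => Nat.rec ⟨W, subset_rfl, hW, hWs, hne⟩ (fun i V => F V i) n
  have hV : ∀ n, closure (V (n + 1)).1 ⊆ (V n).1 \ E n := fun n => hF (V n) n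
  obtain ⟨x, hx⟩ := IsCompact.nonempty_iInter_of_sequence_nonempty_isCompact_isClosed
    (fun n => closure (V n).1 ∩ G)
    (fun n => inter_subset_inter_left _ ((hV n).trans (sdiff_subset.trans subset_closure)))
    (fun n => (V n).2.2.2.2.mono (inter_subset_inter_left _ subset_closure))
    (isClosed_closure.inter hG).isCompact (fun n => isClosed_closure.inter hG)
  rw [mem_iInter] at hx
  exact ⟨x, ⟨(hV 0 (hx 1).1).1, (hx 0).2⟩, fun i => (hV i (hx (i + 1)).1).2⟩

theorem exists_mem_notMem (hE : IsNullFamily E) {W : Set Sphere2} (hW : IsOpen W)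
    (hWs : IsSaturated E W) (hne : W.Nonempty) : ∃ x ∈ W, ∀ i, x ∉ E i := by
  have key : ∀ V ⊆ W, IsOpen V → IsSaturated E V → (V ∩ univ).Nonempty →
      ∀ i, ∃ x ∈ V ∩ univ, x ∉ E i := by
    intro V _ hVo hVs ⟨x, hx, _⟩ i
    by_contra! hi
    have hVi : V = E i := subset_antisymm (fun y hy => hi y ⟨hy, trivial⟩)
      (hVs i x (hi x ⟨hx, trivial⟩) hx)
    exact hE.ne_univ i (IsClopen.eq_univ ⟨hE.isClosed i, hVi ▸ hVo⟩ ⟨x, hi x ⟨hx, trivial⟩⟩)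
  obtain ⟨x, hx, h⟩ := hE.exists_notMem hW hWs isClosed_univ (by simpa using hne) key
  exact ⟨x, hx.1, h⟩

theorem isSaturated_connectedComponentIn (hE : IsNullFamily E) {O : Set Sphere2}
    (hO : IsSaturated E O) (x : Sphere2) : IsSaturated E (connectedComponentIn O x) := by
  intro i y hi hy
  rw [connectedComponentIn_eq hy]
  exact (hE.isPreconnected i).subset_connectedComponentIn hi
    (hO i y hi (connectedComponentIn_subset _ _ hy))

/-- Removing all members of a null family from a connected saturated open set leaves it
connected. -/
theorem isPreconnected_diff (hE : IsNullFamily E) {W : Set Sphere2} (hW : IsOpen W)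
    (hWs : IsSaturated E W) (hWc : IsPreconnected W) : IsPreconnected (W \ ⋃ i, E i) := by
  rintro U₁ U₂ hU₁ hU₂ hcov ⟨a, ha, ha₁⟩ ⟨b, hb, hb₂⟩
  by_contra hemp
  have hdis : ∀ x ∈ W \ ⋃ i, E i, x ∈ U₁ → x ∉ U₂ := fun x hx h1 h2 => hemp ⟨x, hx, h1, h2⟩
  let P : Set Sphere2 → Set Sphere2 := fun U =>
    {x | ∀ O, IsOpen O → IsSaturated E O → x ∈ O → (O ∩ (W \ ⋃ i, E i) ∩ U).Nonempty}
  have hPc : ∀ U, IsClosed (P U) := by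
    intro U
    rw [← isOpen_compl_iff, isOpen_iff_mem_nhds]
    intro x hx
    simp only [P, mem_compl_iff, mem_ofPred_eq, not_forall] at hx
    obtain ⟨O, hO, hOs, hxO, hn⟩ := hx
    filter_upwards [hO.mem_nhds hxO] with y hy h using hn (h O hO hOs hy)
  have hPs : ∀ U, IsSaturated E (P U) := fun U i x hi hx y hy O hO hOs hyO =>
    hx O hO hOs (hOs i y hy hyO hi)
  have hPm : ∀ U, ∀ x ∈ W \ ⋃ i, E i, x ∈ U → x ∈ P U := fun U x hx hxU O _ _ hxO =>
    ⟨x, ⟨hxO, hx⟩, hxU⟩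
  have hPcov : W ⊆ P U₁ ∪ P U₂ := by
    intro x hx
    by_contra! hn
    simp only [P, mem_union, mem_ofPred_eq, not_or, not_forall] at hn
    obtain ⟨⟨O₁, hO₁, hs₁, hx₁, hn₁⟩, O₂, hO₂, hs₂, hx₂, hn₂⟩ := hn
    obtain ⟨y, hy, hyE⟩ := hE.exists_mem_notMem ((hO₁.inter hO₂).inter hW)
      ((hs₁.inter hs₂).inter hWs) ⟨x, ⟨hx₁, hx₂⟩, hx⟩
    have hyR : y ∈ W \ ⋃ i, E i := ⟨hy.2, by simpa using hyE⟩
    rcases hcov hyR with h | h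
    · exact hn₁ ⟨y, ⟨hy.1.1, hyR⟩, h⟩
    · exact hn₂ ⟨y, ⟨hy.1.2, hyR⟩, h⟩
  have hPR : ∀ U U', IsOpen U → (∀ x ∈ W \ ⋃ i, E i, x ∈ U → x ∉ U') →
      ∀ x ∈ W \ ⋃ i, E i, x ∈ U → x ∉ P U' := by
    intro U U' hU h x hx hxU hxP
    obtain ⟨y, hy, hyU'⟩ := hxP _ (hE.isOpen_satCore hU) (hE.isSaturated_satCore U)
      (mem_satCore_of_notMem hxU (by simpa using hx.2))
    exact h y hy.2 (satCore_subset E U hy.1) hyU'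
  have hFR : ∀ x ∈ W \ ⋃ i, E i, x ∉ P U₁ ∩ P U₂ := by
    rintro x hx ⟨h1, h2⟩
    rcases hcov hx with h | h
    · exact hPR U₁ U₂ hU₁ hdis x hx h h2
    · exact hPR U₂ U₁ hU₂ (fun x hx h2 h1 => hdis x hx h1 h2) x hx h h1
  have hFne : (W ∩ (P U₁ ∩ P U₂)).Nonempty :=
    isPreconnected_closed_iff.1 hWc _ _ (hPc _) (hPc _) hPcov ⟨a, ha.1, hPm _ a ha ha₁⟩
      ⟨b, hb.1, hPm _ b hb hb₂⟩
  have key : ∃ V ⊆ W, IsOpen V ∧ IsSaturated E V ∧ (V ∩ (P U₁ ∩ P U₂)).Nonempty ∧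
      ∃ i, ∀ x ∈ V ∩ (P U₁ ∩ P U₂), x ∈ E i := by
    by_contra! hcon
    obtain ⟨x, hx, hxE⟩ := hE.exists_notMem hW hWs ((hPc U₁).inter (hPc U₂)) hFne hcon
    exact hFR x ⟨hx.1, by simpa using hxE⟩ hx.2
  obtain ⟨V, hVW, hVo, hVs, ⟨x, hxV, hxP⟩, i, hi⟩ := key
  have hxi := hi x ⟨hxV, hxP⟩
  let N := connectedComponentIn V x
  have hNo : IsOpen N := hVo.connectedComponentIn
  have hNs : IsSaturated E N := hE.isSaturated_connectedComponentIn hVs x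
  have hxN : x ∈ N := mem_connectedComponentIn hxV
  have hNV : N ⊆ V := connectedComponentIn_subset _ _
  have hNi : IsPreconnected (N \ E i) := isPreconnected_diff_of_hasContLogs
    isPreconnected_connectedComponentIn hNo (hE.hasContLogs i) (hE.isClosed i) (hNs i x hxi hxN)
  have hpt : ∀ U, x ∈ P U → ((N \ E i) ∩ P U).Nonempty := by
    intro U hU
    obtain ⟨y, ⟨hyN, hyR⟩, hyU⟩ := hU N hNo hNs hxN
    exact ⟨y, ⟨hyN, fun h => hyR.2 (mem_iUnion_of_mem i h)⟩, hPm U y hyR hyU⟩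
  obtain ⟨y, hy, hyP⟩ := isPreconnected_closed_iff.1 hNi _ _ (hPc U₁) (hPc U₂)
    (fun y hy => hPcov (hVW (hNV hy.1))) (hpt _ hxP.1) (hpt _ hxP.2)
  exact hy.2 (hi y ⟨hNV hy.1, hyP⟩)

/-- Points outside the family have arbitrarily small connected saturated neighbourhoods. -/
theorem exists_isOpen_isPreconnected (hE : IsNullFamily E) {O : Set Sphere2} (hO : IsOpen O)
    {x : Sphere2} (hx : x ∈ O) (hxE : ∀ i, x ∉ E i) :
    ∃ V ⊆ O, IsOpen V ∧ IsSaturated E V ∧ IsPreconnected V ∧ x ∈ V :=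
  ⟨connectedComponentIn (satCore E O) x,
    (connectedComponentIn_subset _ _).trans (satCore_subset E O),
    (hE.isOpen_satCore hO).connectedComponentIn,
    hE.isSaturated_connectedComponentIn (hE.isSaturated_satCore O) x,
    isPreconnected_connectedComponentIn,
    mem_connectedComponentIn (mem_satCore_of_notMem hx hxE)⟩

end IsNullFamily

/-- Consecutive points among `z 0, …, z N` lie in common open connected subsets of `V` of
diameter at most `ε`. -/
def IsFineChain {X : Type*} [MetricSpace X] (V : Set X) (ε : ℝ) (z : ℕ → X) (N : ℕ) : Prop :=
  ∀ i < N, ∃ U ⊆ V, IsOpen U ∧ IsPreconnected U ∧ (∀ p ∈ U, ∀ q ∈ U, dist p q ≤ ε) ∧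
    z i ∈ U ∧ z (i + 1) ∈ U

section Chains

variable {X : Type*} [MetricSpace X]

theorem IsFineChain.mono {V V' : Set X} {ε : ℝ} {z : ℕ → X} {N : ℕ} (h : IsFineChain V ε z N)
    (hV : V ⊆ V') : IsFineChain V' ε z N := fun i hi =>
  let ⟨U, hU, h⟩ := h i hi
  ⟨U, hU.trans hV, h⟩

theorem IsFineChain.mem {V : Set X} {ε : ℝ} {z : ℕ → X} {N : ℕ} (h : IsFineChain V ε z N)
    (hN : 0 < N) {i : ℕ} (hi : i ≤ N) : z i ∈ V := by
  rcases hi.lt_or_eq with hi | rfl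
  · obtain ⟨U, hU, -, -, -, hz, -⟩ := h i hi
    exact hU hz
  · obtain ⟨U, hU, -, -, -, -, hz⟩ := h (i - 1) (by omega)
    rw [Nat.sub_add_cancel hN] at hz
    exact hU hz

theorem exists_isFineChain [LocallyConnectedSpace X] {V : Set X} (hV : IsOpen V)
    (hVc : IsPreconnected V) {ε : ℝ} (hε : 0 < ε) {p q : X} (hp : p ∈ V) (hq : q ∈ V) :
    ∃ M₀ : ℕ, ∀ M ≥ M₀, ∃ z : ℕ → X, z 0 = p ∧ z M = q ∧ IsFineChain V ε z M := by
  refine hVc.induction₂' (fun p q => ∃ M₀ : ℕ, ∀ M ≥ M₀, ∃ z : ℕ → X, z 0 = p ∧ z M = q ∧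
    IsFineChain V ε z M) ?_ ?_ hp hq
  · intro x hx
    let U := connectedComponentIn (V ∩ ball x (ε / 2)) x
    have hUo : IsOpen U := (hV.inter isOpen_ball).connectedComponentIn
    have hxU : x ∈ U := mem_connectedComponentIn ⟨hx, mem_ball_self (half_pos hε)⟩
    have hUV : U ⊆ V ∩ ball x (ε / 2) := connectedComponentIn_subset _ _
    have hUd : ∀ p ∈ U, ∀ q ∈ U, dist p q ≤ ε := fun p hp q hq => by
      have h1 := mem_ball.1 (hUV hp).2
      have h2 := mem_ball'.1 (hUV hq).2
      linarith [dist_triangle p x q]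
    have key : ∀ p ∈ U, ∀ q ∈ U, ∃ M₀ : ℕ, ∀ M ≥ M₀, ∃ z : ℕ → X, z 0 = p ∧ z M = q ∧
        IsFineChain V ε z M := by
      intro p hp q hq
      refine ⟨1, fun M hM => ⟨fun i => if i = 0 then p else q, if_pos rfl,
        if_neg (by omega), fun i _ => ⟨U, hUV.trans inter_subset_left, hUo,
          isPreconnected_connectedComponentIn, hUd, ?_, ?_⟩⟩⟩
      · dsimp only
        split_ifs <;> assumption
      · dsimp only
        split_ifs <;> assumption
    filter_upwards [mem_nhdsWithin_of_mem_nhds (hUo.mem_nhds hxU)] with y hy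
    exact ⟨key x hxU y hy, key y hy x hxU⟩
  · rintro x y w - - - ⟨M₁, h₁⟩ ⟨M₂, h₂⟩
    refine ⟨M₁ + M₂, fun M hM => ?_⟩
    obtain ⟨z₁, hz₁, hz₁', hc₁⟩ := h₁ M₁ le_rfl
    obtain ⟨z₂, hz₂, hz₂', hc₂⟩ := h₂ (M - M₁) (by omega)
    let z : ℕ → X := fun i => if i < M₁ then z₁ i else z₂ (i - M₁)
    have e₁ : ∀ i ≤ M₁, z i = z₁ i := by
      intro i hi
      rcases hi.lt_or_eq with hi | rfl
      · exact if_pos hi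
      · simp [z, hz₂, hz₁']
    have e₂ : ∀ i ≥ M₁, z i = z₂ (i - M₁) := fun i hi => if_neg (by omega)
    refine ⟨z, by rw [e₁ 0 (by omega), hz₁], by rw [e₂ M (by omega), hz₂'], fun i hi => ?_⟩
    by_cases hi' : i < M₁
    · rw [e₁ i hi'.le, e₁ (i + 1) hi']
      exact hc₁ i hi'
    · rw [e₂ i (by omega), e₂ (i + 1) (by omega), show i + 1 - M₁ = i - M₁ + 1 by omega]
      exact hc₂ _ (by omega)

theorem IsFineChain.exists_refinement [LocallyConnectedSpace X] {V : Set X} {ε ε' : ℝ}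
    (hε' : 0 < ε') {z : ℕ → X} {N : ℕ} (h : IsFineChain V ε z N) :
    ∃ M > 0, ∃ z' : ℕ → X, z' 0 = z 0 ∧ z' (N * M) = z N ∧ IsFineChain V ε' z' (N * M) ∧
      ∀ i < N, ∀ j ≤ M, dist (z' (i * M + j)) (z i) ≤ ε := by
  have : Nonempty X := ⟨z 0⟩
  choose! U hUV hUo hUc hUd hz hz' using h
  choose! M₀ hM₀ using fun i hi => exists_isFineChain (hUo i hi) (hUc i hi) hε' (hz i hi) (hz' i hi)
  let M := ∑ i ∈ Finset.range N, M₀ i + 1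
  have hM : ∀ i < N, M₀ i ≤ M := fun i hi =>
    (Finset.single_le_sum (f := M₀) (fun _ _ => Nat.zero_le _) (Finset.mem_range.2 hi)).trans
      (Nat.le_succ _)
  have hM0 : 0 < M := Nat.succ_pos _
  choose! w hw0 hw1 hwc using fun i hi => hM₀ i hi M (hM i hi)
  let z' : ℕ → X := fun m => if m < N * M then w (m / M) (m % M) else z N
  have e : ∀ i < N, ∀ j ≤ M, z' (i * M + j) = w i j := by
    intro i hi j hj
    rcases hj.lt_or_eq with hj | hj
    · have h1 : i * M + j < N * M := by
        calc i * M + j < i * M + M := by omega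
          _ = (i + 1) * M := by ring
          _ ≤ N * M := Nat.mul_le_mul_right _ hi
      have h2 : (i * M + j) / M = i := by
        rw [mul_comm, Nat.mul_add_div hM0, Nat.div_eq_of_lt hj, add_zero]
      have h3 : (i * M + j) % M = j := by
        rw [mul_comm, Nat.mul_add_mod, Nat.mod_eq_of_lt hj]
      simp only [z', if_pos h1, h2, h3]
    · rw [hj, hw1 i hi, show i * M + M = (i + 1) * M by ring]
      rcases (Nat.succ_le_of_lt hi).lt_or_eq with hi' | hi'
      · have h1 : (i + 1) * M < N * M := Nat.mul_lt_mul_of_pos_right hi' hM0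
        simp only [z', if_pos h1, Nat.mul_div_cancel _ hM0, Nat.mul_mod_left]
        exact hw0 _ hi'
      · have : i + 1 = N := hi'
        simp [z', this]
  refine ⟨M, hM0, z', ?_, by simp [z'], fun m hm => ?_, fun i hi j hj => ?_⟩
  · rcases Nat.eq_zero_or_pos N with rfl | hN
    · simp [z']
    · have := e 0 hN 0 (Nat.zero_le _)
      rw [zero_mul, zero_add] at this
      rw [this, hw0 0 hN]
  · have hi : m / M < N := Nat.div_lt_of_lt_mul (by rwa [mul_comm])
    have hj := Nat.mod_lt m hM0
    have hm' : m / M * M + m % M = m := Nat.div_add_mod' m M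
    have e1 := e _ hi _ hj.le
    have e2 := e _ hi (m % M + 1) hj
    rw [← add_assoc, hm'] at e2
    rw [hm'] at e1
    rw [e1, e2]
    exact (hwc _ hi).mono (hUV _ hi) _ hj
  · rw [e i hi j hj]
    exact hUd i hi _ ((hwc i hi).mem hM0 hj) _ (hz i hi)

theorem joinedIn_closure_of_isPreconnected [CompleteSpace X] [LocallyConnectedSpace X] {V : Set X}
    (hV : IsOpen V) (hVc : IsPreconnected V) {a b : X} (ha : a ∈ V) (hb : b ∈ V) :
    JoinedIn (closure V) a b := by
  let ε : ℕ → ℝ := fun n => 1 / 2 / 2 ^ n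
  have hε : ∀ n, 0 < ε n := fun n => by positivity
  let T : ℕ → Type _ := fun n => {d : ℕ × (ℕ → X) // 0 < d.1 ∧ d.2 0 = a ∧ d.2 d.1 = b ∧
    IsFineChain V (ε n) d.2 d.1}
  have step : ∀ n (d : T n), ∃ d' : T (n + 1), ∃ M > 0, d'.1.1 = d.1.1 * M ∧
      ∀ i < d.1.1, ∀ j ≤ M, dist (d'.1.2 (i * M + j)) (d.1.2 i) ≤ ε n := by
    rintro n ⟨⟨N, z⟩, hN, h0, h1, hc⟩
    obtain ⟨M, hM, z', hz0, hz1, hz', hd⟩ := hc.exists_refinement (hε (n + 1))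
    exact ⟨⟨⟨N * M, z'⟩, Nat.mul_pos hN hM, hz0.trans h0, hz1.trans h1, hz'⟩, M, hM, rfl, hd⟩
  choose F M hM hFM hF using step
  obtain ⟨M₀, hM₀⟩ := exists_isFineChain hV hVc (hε 0) ha hb
  obtain ⟨z₀, h1, h2, h3⟩ := hM₀ (M₀ + 1) (Nat.le_succ _)
  let s : ∀ n, T n := fun n => Nat.rec (motive := T) ⟨⟨M₀ + 1, z₀⟩, Nat.succ_pos _, h1, h2, h3⟩
    (fun n d => F n d) n
  let N : ℕ → ℕ := fun n => (s n).1.1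
  let z : ℕ → ℕ → X := fun n => (s n).1.2
  have hN : ∀ n, 0 < N n := fun n => (s n).2.1
  have hz0 : ∀ n, z n 0 = a := fun n => (s n).2.2.1
  have hz1 : ∀ n, z n (N n) = b := fun n => (s n).2.2.2.1
  have hzc : ∀ n, IsFineChain V (ε n) (z n) (N n) := fun n => (s n).2.2.2.2
  let f : ℕ → unitInterval → X := fun n t => z n ⌊(t : ℝ) * N n⌋₊
  have hfl : ∀ n (t : unitInterval), ⌊(t : ℝ) * N n⌋₊ ≤ N n := fun n t => by
    refine Nat.floor_le_of_le ?_
    exact mul_le_of_le_one_left (Nat.cast_nonneg _) t.2.2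
  have hstep : ∀ (t : unitInterval) n, dist (f n t) (f (n + 1) t) ≤ 1 / 2 / 2 ^ n := by
    intro t n
    have hN' : N (n + 1) = N n * M n (s n) := hFM n (s n)
    have hM0 : 0 < M n (s n) := hM n (s n)
    rcases t.2.2.lt_or_eq with ht | ht
    · have hi : ⌊(t : ℝ) * N n⌋₊ = ⌊(t : ℝ) * N (n + 1)⌋₊ / M n (s n) := by
        rw [← Nat.floor_div_natCast, hN']
        congr 1
        push_cast
        field_simp
      have hiN : ⌊(t : ℝ) * N n⌋₊ < N n := by
        rw [Nat.floor_lt (mul_nonneg t.2.1 (Nat.cast_nonneg _))]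
        exact mul_lt_of_lt_one_left (Nat.cast_pos.2 (hN n)) ht
      have := hF n (s n) _ hiN (⌊(t : ℝ) * N (n + 1)⌋₊ % M n (s n)) (Nat.mod_lt _ hM0).le
      rw [hi, Nat.div_add_mod', ← hi, dist_comm] at this
      exact this
    · simp only [f, ht, one_mul, Nat.floor_natCast, hz1, dist_self]
      positivity
  choose g hg using fun t => cauchySeq_tendsto_of_complete (cauchySeq_of_le_geometric_two (hstep t))
  have hgd : ∀ t n, dist (f n t) (g t) ≤ 1 / 2 ^ n := fun t n =>
    dist_le_of_le_geometric_two_of_tendsto (hstep t) (hg t) n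
  have hfd : ∀ n (x y : unitInterval), x ≤ y → dist (x : ℝ) y < 1 / N n →
      dist (f n x) (f n y) ≤ 1 / 2 ^ n := by
    intro n x y hxy hd
    have hNp : (0 : ℝ) < N n := Nat.cast_pos.2 (hN n)
    have hle : ⌊(x : ℝ) * N n⌋₊ ≤ ⌊(y : ℝ) * N n⌋₊ :=
      Nat.floor_mono (mul_le_mul_of_nonneg_right hxy hNp.le)
    have hle' : ⌊(y : ℝ) * N n⌋₊ ≤ ⌊(x : ℝ) * N n⌋₊ + 1 := by
      rw [← Nat.floor_add_one (mul_nonneg x.2.1 hNp.le)]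
      refine Nat.floor_mono ?_
      rw [dist_comm, Real.dist_eq, abs_of_nonneg (sub_nonneg.2 (Subtype.coe_le_coe.2 hxy)), lt_div_iff₀ hNp] at hd
      linarith
    rcases hle.lt_or_eq with h | h
    · have h' : ⌊(y : ℝ) * N n⌋₊ = ⌊(x : ℝ) * N n⌋₊ + 1 := le_antisymm hle' h
      obtain ⟨U, -, -, -, hU, hx, hy⟩ := hzc n _ (h.trans_le (hfl n y))
      rw [← h'] at hy
      refine (hU _ hx _ hy).trans ?_
      exact div_le_div_of_nonneg_right (by norm_num) (by positivity)
    · simp only [f, h, dist_self]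
      positivity
  have hcont : Continuous g := by
    rw [Metric.continuous_iff]
    intro t δ hδ
    obtain ⟨n, hn⟩ := exists_pow_lt_of_lt_one (by positivity : 0 < δ / 3)
      (by norm_num : (1 / 2 : ℝ) < 1)
    rw [one_div_pow] at hn
    refine ⟨1 / N n, one_div_pos.2 (Nat.cast_pos.2 (hN n)), fun y hy => ?_⟩
    have hyt : dist (f n y) (f n t) ≤ 1 / 2 ^ n := by
      rcases le_total y t with h | h
      · exact hfd n y t h hy
      · rw [dist_comm]
        exact hfd n t y h (by rw [dist_comm]; exact hy)
    calc dist (g y) (g t) ≤ dist (g y) (f n y) + dist (f n y) (f n t) + dist (f n t) (g t) :=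
          dist_triangle4 _ _ _ _
      _ ≤ 1 / 2 ^ n + 1 / 2 ^ n + 1 / 2 ^ n := by
          gcongr
          · rw [dist_comm]; exact hgd y n
          · exact hgd t n
      _ < δ := by linarith
  refine ⟨⟨⟨g, hcont⟩, ?_, ?_⟩, fun t => ?_⟩
  · refine tendsto_nhds_unique (hg 0) ?_
    simp [f, hz0]
  · refine tendsto_nhds_unique (hg 1) ?_
    simp [f, hz1]
  · exact mem_closure_of_tendsto (hg t)
      (Filter.Eventually.of_forall fun n => (hzc n).mem (hN n) (hfl n t))

theorem locallyPathConnectedSpace_of_completeSpace [CompleteSpace X] [LocallyConnectedSpace X] :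
    LocallyPathConnectedSpace X := by
  refine ⟨fun x => Filter.hasBasis_self.2 fun O hO => ?_⟩
  obtain ⟨O', hO', hc, hO'O⟩ := exists_mem_nhds_isClosed_subset hO
  let V := connectedComponentIn (interior O') x
  have hx : x ∈ interior O' := mem_interior_iff_mem_nhds.2 hO'
  have hVo : IsOpen V := isOpen_interior.connectedComponentIn
  have hxV : x ∈ V := mem_connectedComponentIn hx
  have hVO : closure V ⊆ O :=
    (closure_minimal ((connectedComponentIn_subset _ _).trans interior_subset) hc).trans hO'O
  refine ⟨pathComponentIn O x, Filter.mem_of_superset (hVo.mem_nhds hxV) fun y hy => ?_,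
    isPathConnected_pathComponentIn (hVO (subset_closure hxV)), pathComponentIn_subset⟩
  exact (joinedIn_closure_of_isPreconnected hVo isPreconnected_connectedComponentIn hxV hy).mono hVO

end Chains

/-- The Mazurkiewicz-Moore-Menger theorem. -/
theorem locallyPathConnectedSpace_of_isCompletelyMetrizableSpace {X : Type*} [TopologicalSpace X]
    [TopologicalSpace.IsCompletelyMetrizableSpace X] [LocallyConnectedSpace X] :
    LocallyPathConnectedSpace X :=
  let := TopologicalSpace.upgradeIsCompletelyMetrizable X
  locallyPathConnectedSpace_of_completeSpace

theorem isCompletelyMetrizableSpace_compl_iUnion {X : Type*} [TopologicalSpace X] [PolishSpace X]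
    {E : ℕ → Set X} (hE : ∀ i, IsClosed (E i)) :
    TopologicalSpace.IsCompletelyMetrizableSpace ↥((⋃ i, E i)ᶜ) := by
  have := fun i => (hE i).isOpen_compl.polishSpace
  let F : ↥((⋃ i, E i)ᶜ) → ∀ i, ↥((E i)ᶜ) := fun x i =>
    ⟨x, fun h => x.2 (mem_iUnion_of_mem i h)⟩
  have hF : Continuous F := by fun_prop
  have hemb : IsEmbedding F := by
    refine IsEmbedding.of_comp hF (g := fun y => (y 0 : X)) (by fun_prop) ?_
    exact IsEmbedding.subtypeVal
  have hr : range F = {y | ∀ i, (y i : X) = y 0} := by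
    ext y
    constructor
    · rintro ⟨x, rfl⟩ i
      rfl
    · intro h
      refine ⟨⟨y 0, ?_⟩, ?_⟩
      · simp only [mem_compl_iff, mem_iUnion, not_exists]
        intro i hi
        exact (y i).2 (by rw [h i]; exact hi)
      · ext i
        exact (h i).symm
  refine IsClosedEmbedding.IsCompletelyMetrizableSpace (f := F) ⟨hemb, ?_⟩
  rw [hr, ofPred_forall]
  exact isClosed_iInter fun i => isClosed_eq (by fun_prop) (by fun_prop)

namespace IsNullFamily

variable {E : ℕ → Set Sphere2}

theorem locallyConnectedSpace (hE : IsNullFamily E) :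
    LocallyConnectedSpace ↥((⋃ i, E i)ᶜ) := by
  refine locallyConnectedSpace_of_connected_bases (fun x V => V) (fun x V => V ∈ 𝓝 x ∧ IsPreconnected V)
    (fun x => Filter.hasBasis_self.2 fun O hO => ?_) (fun _ _ h => h.2)
  obtain ⟨O', hO', hOO⟩ := mem_nhds_induced _ _ _ |>.1 hO
  obtain ⟨V, hVO, hVo, hVs, hVc, hxV⟩ := hE.exists_isOpen_isPreconnected isOpen_interior
    (mem_interior_iff_mem_nhds.2 hO') (x := x) (by simpa using x.2)
  refine ⟨Subtype.val ⁻¹' V, hVo.preimage continuous_subtype_val |>.mem_nhds hxV, ?_,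
    (preimage_mono (hVO.trans interior_subset)).trans hOO⟩
  rw [← IsInducing.subtypeVal.isPreconnected_image, Subtype.image_preimage_coe, inter_comm]
  exact hE.isPreconnected_diff hVo hVs hVc

theorem joinedIn (hE : IsNullFamily E) {W : Set Sphere2} (hW : IsOpen W) (hWs : IsSaturated E W)
    (hWc : IsPreconnected W) {x y : Sphere2} (hx : x ∈ W \ ⋃ i, E i) (hy : y ∈ W \ ⋃ i, E i) :
    JoinedIn (W \ ⋃ i, E i) x y := by
  have := isCompletelyMetrizableSpace_compl_iUnion hE.isClosed
  have := hE.locallyConnectedSpace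
  have := locallyPathConnectedSpace_of_isCompletelyMetrizableSpace (X := ↥((⋃ i, E i)ᶜ))
  have hc : IsConnected (Subtype.val ⁻¹' W : Set ↥((⋃ i, E i)ᶜ)) := by
    refine ⟨⟨⟨x, hx.2⟩, hx.1⟩, ?_⟩
    rw [← IsInducing.subtypeVal.isPreconnected_image, Subtype.image_preimage_coe, inter_comm]
    exact hE.isPreconnected_diff hW hWs hWc
  have hp := ((hW.preimage continuous_subtype_val).isConnected_iff_isPathConnected.1 hc).image
    continuous_subtype_val
  rw [Subtype.image_preimage_coe, inter_comm] at hp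
  exact hp.joinedIn _ hx _ hy

end IsNullFamily

/-- Infinite concatenation of paths which shrink to a point. -/
theorem joinedIn_insert_of_forall_joinedIn {X : Type*} [TopologicalSpace X] {T : Set X}
    {S : ℕ → Set X} {y : ℕ → X} {c : X} (hST : ∀ n, S n ⊆ T)
    (hj : ∀ n, JoinedIn (S n) (y n) (y (n + 1))) (hc : ∀ V ∈ 𝓝 c, ∃ N, ∀ n ≥ N, S n ⊆ V) :
    JoinedIn (insert c T) (y 0) c := by
  classical
  let γ := fun n => (hj n).somePath
  have hγ : ∀ n s, (γ n).extend s ∈ S n := fun n s => by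
    have : (γ n).extend s ∈ range (γ n).extend := mem_range_self s
    rw [Path.extend_range] at this
    obtain ⟨t, ht⟩ := this
    rw [← ht]
    exact (hj n).somePath_mem t
  let P : ℕ → ℝ → X := fun n => (γ n).extend
  let f : NNReal → X := fun t => P ⌊t⌋₊ (t - ⌊t⌋₊)
  have hfC : ∀ n : ℕ, EqOn f (fun t => P n (t - n)) (Icc (n : NNReal) (n + 1)) := by
    intro n t ht
    rcases ht.2.lt_or_eq with h | h
    · have : ⌊t⌋₊ = n := (Nat.floor_eq_iff (zero_le)).2 ⟨ht.1, h⟩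
      simp only [f, this]
    · have h1 : ⌊t⌋₊ = n + 1 := by rw [h]; exact_mod_cast Nat.floor_natCast (R := NNReal) (n + 1)
      simp only [f, h1]
      simp [P, h]
  have hf : Continuous f := by
    refine LocallyFinite.continuous (f := fun n : ℕ => Icc (n : NNReal) (n + 1)) ?_ ?_
      (fun n => isClosed_Icc) (fun n => ?_)
    · intro x
      refine ⟨Iio (x + 1), Iio_mem_nhds (lt_add_one x), (finite_lt_nat ⌈x + 1⌉₊).subset ?_⟩
      rintro n ⟨t, ht, htx⟩
      exact Nat.lt_ceil.2 (ht.1.trans_lt htx)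
    · refine eq_univ_of_forall fun t => mem_iUnion.2 ⟨⌊t⌋₊, Nat.floor_le (zero_le), ?_⟩
      exact (Nat.lt_floor_add_one t).le
    · refine ContinuousOn.congr (Continuous.continuousOn ?_) (hfC n)
      exact (γ n).continuous_extend.comp (by fun_prop)
  let p : unitInterval → X := fun t => if t = 1 then c else f (Real.toNNReal (t / (1 - t)))
  have hp : Continuous p := by
    rw [continuous_iff_continuousAt]
    intro t
    by_cases ht : t = 1
    · subst ht
      intro V hV
      simp only [p, if_true] at hV
      obtain ⟨N, hN⟩ := hc V hV
      have hlt : (N / (N + 1) : ℝ) < ((1 : unitInterval) : ℝ) := by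
        rw [Icc.coe_one, div_lt_one (by positivity)]
        linarith
      have hev : ∀ᶠ t : unitInterval in 𝓝 1, (N / (N + 1) : ℝ) < t :=
        continuous_subtype_val.continuousAt.eventually (lt_mem_nhds hlt)
      rw [Filter.mem_map]
      filter_upwards [hev] with s hs
      by_cases hs1 : s = 1
      · simp only [mem_preimage, p, if_pos hs1]
        exact mem_of_mem_nhds hV
      · simp only [mem_preimage, p, if_neg hs1]
        have h1 : (0 : ℝ) < 1 - s := sub_pos.2 (lt_of_le_of_ne s.2.2 fun h => hs1 (Subtype.ext h))
        refine hN _ (Nat.le_floor ?_) (hγ _ _)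
        rw [Real.le_toNNReal_iff_coe_le (by exact div_nonneg s.2.1 h1.le), le_div_iff₀ h1]
        rw [div_lt_iff₀ (by positivity)] at hs
        push_cast
        nlinarith
    · have hne : ∀ᶠ s in 𝓝 t, p s = f (Real.toNNReal (s / (1 - s))) := by
        filter_upwards [isOpen_compl_singleton.mem_nhds ht] with s hs using if_neg hs
      refine ContinuousAt.congr ?_ (hne.mono fun _ h => h.symm)
      have h1 : (1 - t : ℝ) ≠ 0 := fun h => ht (Subtype.ext (sub_eq_zero.1 h).symm)
      refine hf.continuousAt.comp (continuous_real_toNNReal.continuousAt.comp ?_)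
      exact ContinuousAt.div (by fun_prop) (by fun_prop) h1
  refine ⟨⟨⟨p, hp⟩, ?_, by simp [p]⟩, fun t => ?_⟩
  · change p 0 = _
    simp [p, f, P]
  · change p t ∈ _
    by_cases ht : t = 1
    · exact .inl (if_pos ht)
    · simp only [p, if_neg ht]
      exact .inr (hST _ (hγ _ _))

/-- Near `c`, the set `K` is a small non-separating set attached to the rest of `K` along a union
of at most `k + 1` connected sets. -/
def IsTamePoint (k : ℕ) (K : Set Sphere2) (c : Sphere2) : Prop :=
  ∀ V, IsOpen V → c ∈ V → ∃ D D', IsClosed D ∧ IsClosed D' ∧ D ∪ D' = K ∧ D ⊆ V ∧ c ∉ D' ∧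
    HasContLogs D ∧ ∃ S : Fin (k + 1) → Set Sphere2, (∀ j, IsPreconnected (S j)) ∧ D ∩ D' = ⋃ j, S j

theorem IsTamePoint.exists_mem_nhds {k : ℕ} {K : Set Sphere2} {c : Sphere2}
    (h : IsTamePoint k K c) {V : Set Sphere2} (hV : IsOpen V) (hcV : c ∈ V) :
    ∃ V' ∈ 𝓝 c, ∀ x : Fin (k + 2) → Sphere2, (∀ i, x i ∈ V' \ K) →
      ∃ i j, i ≠ j ∧ x j ∈ connectedComponentIn (V \ K) (x i) := by
  obtain ⟨D, D', hD, hD', rfl, hDV, hcD', hDl, S, hS, hDS⟩ := h V hV hcV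
  refine ⟨connectedComponentIn (V \ D') c, ?_, fun x hx => ?_⟩
  · exact (hV.sdiff hD').connectedComponentIn.mem_nhds (mem_connectedComponentIn ⟨hcV, hcD'⟩)
  have e₁ : (D' ∪ Vᶜ)ᶜ = V \ D' := by rw [compl_union, compl_compl, sdiff_eq, inter_comm]
  have e₂ : (D' ∪ Vᶜ ∪ D)ᶜ = V \ (D ∪ D') := by
    ext z
    simp only [mem_compl_iff, mem_union, mem_sdiff]
    tauto
  rw [← e₂]
  refine exists_mem_connectedComponentIn_compl_union (hD'.union hV.isClosed_compl) hD hS ?_ x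
    (fun i => ?_) (fun i => ?_)
  · rw [← hDS]
    ext z
    have := @hDV z
    simp only [mem_inter_iff, mem_union, mem_compl_iff]
    tauto
  · rw [e₁, ← connectedComponentIn_eq (hx 0).1]
    exact (hx i).1
  · rw [(hDl.isPreconnected_compl hD).connectedComponentIn fun h => (hx 0).2 (.inl h)]
    exact fun h => (hx i).2 (.inl h)

theorem IsNullFamily.joinedIn_insert {E : ℕ → Set Sphere2} (hE : IsNullFamily E) {k : ℕ}
    {K : Set Sphere2} (hK : IsClosed K) (hKE : ∀ i, ∀ x ∈ E i, x ∉ K) (hKc : IsPreconnected Kᶜ)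
    {c : Sphere2} (hcK : c ∈ K) (hc : c ∈ closure Kᶜ) (ht : IsTamePoint k K c) {x : Sphere2}
    (hx : x ∈ Kᶜ \ ⋃ i, E i) : JoinedIn (insert c (Kᶜ \ ⋃ i, E i)) x c := by
  have hcE : ∀ i, c ∉ E i := fun i h => hKE i c h hcK
  have hKs : IsSaturated E Kᶜ := fun i _ _ _ y hy => hKE i y hy
  let V : ℕ → Set Sphere2 := fun n => connectedComponentIn (satCore E (ball c (1 / (n + 1)))) c
  have hVo : ∀ n, IsOpen (V n) := fun n => (hE.isOpen_satCore isOpen_ball).connectedComponentIn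
  have hVs : ∀ n, IsSaturated E (V n) := fun n =>
    hE.isSaturated_connectedComponentIn (hE.isSaturated_satCore _) c
  have hcV : ∀ n, c ∈ V n := fun n => mem_connectedComponentIn
    (mem_satCore_of_notMem (mem_ball_self (by positivity)) hcE)
  have hVb : ∀ n, V n ⊆ ball c (1 / (n + 1)) := fun n =>
    (connectedComponentIn_subset _ _).trans (satCore_subset _ _)
  have hVm : ∀ n, V (n + 1) ⊆ V n := by
    intro n
    have hb : ball c (1 / ((n + 1 : ℕ) + 1) : ℝ) ⊆ ball c (1 / (n + 1)) :=
      ball_subset_ball (by push_cast; gcongr; linarith)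
    exact connectedComponentIn_mono _ fun y hy => ⟨hb hy.1, fun i hi => (hy.2 i hi).trans hb⟩
  have hw : ∀ n, ∃ w ∈ V n ∩ Kᶜ, ∀ i, w ∉ E i := fun n =>
    hE.exists_mem_notMem ((hVo n).inter hK.isOpen_compl) ((hVs n).inter hKs)
      (mem_closure_iff.1 hc _ (hVo n) (hcV n))
  choose w hwV hwE using hw
  have hwc : Filter.Tendsto w Filter.atTop (𝓝 c) := by
    rw [tendsto_iff_dist_tendsto_zero]
    exact squeeze_zero (fun _ => dist_nonneg) (fun n => (mem_ball.1 (hVb n (hwV n).1)).le)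
      tendsto_one_div_add_atTop_nhds_zero_nat
  let u : Ultrafilter ℕ := Filter.hyperfilter ℕ
  have huw : Filter.Tendsto w u (𝓝 c) := hwc.mono_left Nat.hyperfilter_le_atTop
  have key : ∀ n, ∃ q, {m | w m ∈ connectedComponentIn (V n \ K) q} ∈ u := by
    intro n
    obtain ⟨V', hV', hfin⟩ := ht.exists_mem_nhds (hVo n) (hcV n)
    let 𝒞 : Set (Set Sphere2) := (fun q => connectedComponentIn (V n \ K) q) '' ((V' ∩ V n) \ K)
    have h𝒞 : 𝒞.Finite := by
      by_contra hinf
      let e := Set.Infinite.natEmbedding 𝒞 hinf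
      choose q hq hqe using fun i : ℕ => (e i).2
      obtain ⟨i, j, hij, h⟩ := hfin (fun i => q i) fun i => ⟨(hq i).1.1, (hq i).2⟩
      have h1 := (hqe i).symm.trans ((connectedComponentIn_eq h).trans (hqe j))
      exact hij (Fin.ext (e.injective (Subtype.ext h1)))
    have hmem : {m | w m ∈ ⋃₀ 𝒞} ∈ u := by
      filter_upwards [huw (Filter.inter_mem hV' ((hVo n).mem_nhds (hcV n)))] with m hm
      exact ⟨_, mem_image_of_mem _ ⟨hm, (hwV m).2⟩, mem_connectedComponentIn ⟨hm.2, (hwV m).2⟩⟩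
    obtain ⟨_, ⟨q, -, rfl⟩, hq⟩ := (Ultrafilter.finite_sUnion_mem_iff (f := u.map w) h𝒞).1 hmem
    exact ⟨q, hq⟩
  choose q hq using key
  let Q : ℕ → Set Sphere2 := fun n => connectedComponentIn (V n \ K) (q n)
  have hQV : ∀ n, Q n ⊆ V n \ K := fun n => connectedComponentIn_subset _ _
  have hQm : ∀ n, Q (n + 1) ⊆ Q n := by
    intro n
    obtain ⟨m, hm₁, hm₂⟩ := u.nonempty_of_mem (Filter.inter_mem (hq n) (hq (n + 1)))
    change w m ∈ Q n at hm₁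
    change w m ∈ Q (n + 1) at hm₂
    have h1 : Q n = connectedComponentIn (V n \ K) (w m) := connectedComponentIn_eq hm₁
    rw [h1]
    exact isPreconnected_connectedComponentIn.subset_connectedComponentIn hm₂
      ((hQV _).trans (sdiff_subset_sdiff_left (hVm n)))
  have hy : ∀ n, ∃ y ∈ Q n, ∀ i, y ∉ E i := by
    intro n
    obtain ⟨m, hm⟩ := u.nonempty_of_mem (hq n)
    exact ⟨w m, hm, hwE m⟩
  choose y hyQ hyE using hy
  have hjoin : ∀ n, JoinedIn (Q n \ ⋃ i, E i) (y n) (y (n + 1)) := fun n =>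
    hE.joinedIn ((hVo n).sdiff hK).connectedComponentIn
      (hE.isSaturated_connectedComponentIn ((hVs n).inter hKs) _)
      isPreconnected_connectedComponentIn ⟨hyQ n, by simpa using hyE n⟩
      ⟨hQm n (hyQ (n + 1)), by simpa using hyE (n + 1)⟩
  have hQK : ∀ n, Q n \ ⋃ i, E i ⊆ Kᶜ \ ⋃ i, E i := fun n =>
    sdiff_subset_sdiff_left fun z hz => (hQV n hz).2
  have h₁ : JoinedIn (Kᶜ \ ⋃ i, E i) x (y 0) :=
    hE.joinedIn hK.isOpen_compl hKs hKc hx (hQK 0 ⟨hyQ 0, by simpa using hyE 0⟩)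
  refine (h₁.mono (subset_insert _ _)).trans (joinedIn_insert_of_forall_joinedIn hQK hjoin ?_)
  intro O hO
  obtain ⟨δ, hδ, hδO⟩ := Metric.mem_nhds_iff.1 hO
  obtain ⟨N, hN⟩ := exists_nat_one_div_lt hδ
  refine ⟨N, fun n hn => sdiff_subset.trans ?_⟩
  refine ((hQV n).trans sdiff_subset).trans ((hVb n).trans ((ball_subset_ball ?_).trans hδO))
  refine le_trans ?_ hN.le
  gcongr

section Arcs

variable {X : Type*} [MetricSpace X]

/-- Sets of parameters which remain after loops of `γ` have been cut out. -/
def IsLoopErasure (γ : ℝ → X) (A : Set ℝ) : Prop :=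
  IsClosed A ∧ A ⊆ Icc 0 1 ∧ 0 ∈ A ∧ 1 ∈ A ∧
    ∀ s ∈ A, ∀ t ∈ A, s < t → Disjoint (Ioo s t) A → γ s = γ t

theorem exists_minimal_isLoopErasure {γ : ℝ → X} (hγ : Continuous γ) :
    ∃ A, Minimal (IsLoopErasure γ) A := by
  refine zorn_superset {A | IsLoopErasure γ A} fun c hc hchain => ?_
  rcases c.eq_empty_or_nonempty with rfl | ⟨A₀, hA₀⟩
  · refine ⟨Icc 0 1, ⟨isClosed_Icc, subset_rfl, by simp, by simp, fun s hs t ht hst hd => ?_⟩,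
      by simp⟩
    obtain ⟨u, hu⟩ := exists_between hst
    exact (Set.disjoint_left.1 hd hu ⟨hs.1.trans hu.1.le, hu.2.le.trans ht.2⟩).elim
  refine ⟨⋂₀ c, ⟨isClosed_sInter fun A hA => (hc hA).1,
    (sInter_subset_of_mem hA₀).trans (hc hA₀).2.1, fun A hA => (hc hA).2.2.1,
    fun A hA => (hc hA).2.2.2.1, fun s hs t ht hst hd => ?_⟩, fun A hA => sInter_subset_of_mem hA⟩
  by_contra hne
  have hev : ∀ᶠ p : ℝ × ℝ in 𝓝 (s, t), γ p.1 ≠ γ p.2 :=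
    (isOpen_ne_fun (hγ.comp continuous_fst) (hγ.comp continuous_snd)).mem_nhds hne
  obtain ⟨δ, hδ, hδγ⟩ := Metric.eventually_nhds_iff.1 hev
  let ε := min (δ / 2) ((t - s) / 3)
  have hε : 0 < ε := lt_min (half_pos hδ) (by linarith)
  have hεδ : ε < δ := (min_le_left _ _).trans_lt (half_lt_self hδ)
  have hεst : ε ≤ (t - s) / 3 := min_le_right _ _
  have : Nonempty c := ⟨⟨A₀, hA₀⟩⟩
  obtain ⟨⟨A, hA⟩, hAd⟩ := (isCompact_Icc (a := s + ε) (b := t - ε)).elim_directed_family_closed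
    (fun A : c => A.1) (fun A => (hc A.2).1) (by
      rw [← sInter_eq_iInter]
      exact Set.disjoint_iff_inter_eq_empty.1 (hd.mono_left
        (Icc_subset_Ioo (by linarith) (by linarith))))
    (by
      intro A B
      rcases hchain.total A.2 B.2 with h | h
      · exact ⟨A, subset_rfl, h⟩
      · exact ⟨B, h, subset_rfl⟩)
  obtain ⟨hAc, hAI, h0, h1, hAγ⟩ := hc hA
  have hsA := hs A hA
  have htA := ht A hA
  have hAd' : ∀ x ∈ A, s + ε ≤ x → t - ε ≤ x := by
    intro x hx hsx
    by_contra! hlt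
    have : x ∈ Icc (s + ε) (t - ε) ∩ A := ⟨⟨hsx, hlt.le⟩, hx⟩
    rw [hAd] at this
    exact this
  have hK₁ : IsCompact (A ∩ Icc s (s + ε)) := isCompact_Icc.inter_left hAc
  have hK₂ : IsCompact (A ∩ Icc (t - ε) t) := isCompact_Icc.inter_left hAc
  have hu := hK₁.sSup_mem ⟨s, hsA, le_rfl, by linarith⟩
  have hv := hK₂.sInf_mem ⟨t, htA, by linarith, le_rfl⟩
  set u := sSup (A ∩ Icc s (s + ε))
  set v := sInf (A ∩ Icc (t - ε) t)
  refine hδγ (y := (u, v)) ?_ (hAγ u hu.1 v hv.1 (by linarith [hu.2.2, hv.2.1]) ?_)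
  · rw [Prod.dist_eq, max_lt_iff, Real.dist_eq, Real.dist_eq, abs_lt, abs_lt]
    constructor <;> constructor <;> linarith [hu.2.1, hu.2.2, hv.2.1, hv.2.2]
  · rw [Set.disjoint_left]
    intro x hx hxA
    rcases le_or_gt x (s + ε) with h | h
    · exact hx.1.not_ge (le_csSup hK₁.bddAbove ⟨hxA, hu.2.1.trans hx.1.le, h⟩)
    · exact hx.2.not_ge (csInf_le hK₂.bddBelow ⟨hxA, hAd' x hxA h.le, hx.2.le.trans hv.2.2⟩)

theorem disjoint_of_minimal_isLoopErasure {Y : Type*} {γ : ℝ → Y} {A : Set ℝ}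
    (hA : Minimal (IsLoopErasure γ) A) {s t : ℝ} (hs : s ∈ A) (ht : t ∈ A)
    (hγ : γ s = γ t) : Disjoint (Ioo s t) A := by
  obtain ⟨hAc, hAI, h0, h1, hAγ⟩ := hA.prop
  have key : IsLoopErasure γ (A \ Ioo s t) := by
    refine ⟨hAc.sdiff isOpen_Ioo, sdiff_subset.trans hAI,
      ⟨h0, fun h => h.1.not_ge (hAI hs).1⟩, ⟨h1, fun h => h.2.not_ge (hAI ht).2⟩,
      fun u hu v hv huv hd => ?_⟩
    by_cases hd' : Disjoint (Ioo u v) A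
    · exact hAγ u hu.1 v hv.1 huv hd'
    obtain ⟨w, hw, hwA⟩ := Set.not_disjoint_iff.1 hd'
    have hw' : w ∈ Ioo s t := by
      by_contra h
      exact Set.disjoint_left.1 hd hw ⟨hwA, h⟩
    have e₁ : u = s := by
      refine le_antisymm ?_ ?_
      · by_contra! h
        exact hu.2 ⟨h, hw.1.trans hw'.2⟩
      · by_contra! h
        exact Set.disjoint_left.1 hd ⟨h, hw'.1.trans hw.2⟩ ⟨hs, fun h => h.1.false⟩
    have e₂ : v = t := by
      refine le_antisymm ?_ ?_
      · by_contra! h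
        exact Set.disjoint_left.1 hd ⟨hw.1.trans hw'.2, h⟩ ⟨ht, fun h => h.2.false⟩
      · by_contra! h
        exact hv.2 ⟨hw'.1.trans hw.2, h⟩
    rw [e₁, e₂, hγ]
  rw [Set.disjoint_left]
  intro x hx hxA
  exact (hA.le_of_le key sdiff_subset hxA).2 hx

/-- Every path can be replaced by one whose fibres are order connected. -/
theorem exists_continuous_ordConnected_fibres {a b : X} (γ : Path a b) :
    ∃ g : unitInterval → X, Continuous g ∧ g 0 = a ∧ g 1 = b ∧ range g ⊆ range γ ∧
      ∀ x y z, x ≤ z → z ≤ y → g x = g y → g z = g x := by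
  obtain ⟨A, hA⟩ := exists_minimal_isLoopErasure γ.continuous_extend
  obtain ⟨hAc, hAI, h0, h1, hAγ⟩ := hA.prop
  have hAk : IsCompact A := isCompact_Icc.of_isClosed_subset hAc hAI
  let P : ℝ → ℝ := fun x => sSup (A ∩ Iic x)
  have hPK : ∀ x, IsCompact (A ∩ Iic x) := fun x => hAk.inter_right isClosed_Iic
  have hP : ∀ x, 0 ≤ x → P x ∈ A ∩ Iic x := fun x hx => (hPK x).sSup_mem ⟨0, h0, hx⟩
  have hPle : ∀ x, ∀ y ∈ A, y ≤ x → y ≤ P x := fun x y hy hyx =>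
    le_csSup (hPK x).bddAbove ⟨hy, hyx⟩
  have hPA : ∀ x ∈ A, P x = x := fun x hx =>
    le_antisymm (hP x (hAI hx).1).2 (hPle x x hx le_rfl)
  have hPm : ∀ x y, 0 ≤ x → x ≤ y → P x ≤ P y := fun x y hx hxy =>
    hPle y _ (hP x hx).1 ((hP x hx).2.trans hxy)
  have hnext : ∀ x, 0 ≤ x → x ≤ 1 → ∃ u ∈ A, x ≤ u ∧ (∀ v ∈ A, x ≤ v → u ≤ v) ∧
      γ.extend (P x) = γ.extend u := by
    intro x hx0 hx1
    have hK : IsCompact (A ∩ Ici x) := hAk.inter_right isClosed_Ici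
    have hu := hK.sInf_mem ⟨1, h1, hx1⟩
    refine ⟨_, hu.1, hu.2, fun v hv hxv => csInf_le hK.bddBelow ⟨hv, hxv⟩, ?_⟩
    rcases (le_trans (mem_Iic.1 (hP x hx0).2) (mem_Ici.1 hu.2)).lt_or_eq with h | h
    · refine hAγ _ (hP x hx0).1 _ hu.1 h (Set.disjoint_left.2 fun y hy hyA => ?_)
      rcases le_total y x with hyx | hyx
      · exact hy.1.not_ge (hPle x y hyA hyx)
      · exact hy.2.not_ge (csInf_le hK.bddBelow ⟨hyA, hyx⟩)
    · rw [h]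
  refine ⟨fun x => γ.extend (P x), ?_, ?_, ?_, ?_, ?_⟩
  · rw [Metric.continuous_iff]
    intro x ε hε
    have huc := γ.uniformContinuous_extend
    obtain ⟨δ, hδ, h⟩ := Metric.uniformContinuous_iff.1 huc ε hε
    refine ⟨δ, hδ, ?_⟩
    have key : ∀ x y : unitInterval, x ≤ y → dist x y < δ →
        dist (γ.extend (P x)) (γ.extend (P y)) < ε := by
      intro x y hxy hd
      obtain ⟨u, huA, hxu, humin, hγu⟩ := hnext x x.2.1 x.2.2
      by_cases hyA : P y < x
      · have : P x = P y := le_antisymm (hPm x y x.2.1 hxy) (hPle x _ (hP y y.2.1).1 hyA.le)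
        rw [this, dist_self]
        exact hε
      · have h1 := humin _ (hP y y.2.1).1 (not_lt.1 hyA)
        have h2 : P y ≤ y := (hP y y.2.1).2
        have hxy' : (x : ℝ) ≤ y := hxy
        rw [hγu]
        apply h
        rw [Subtype.dist_eq, Real.dist_eq, abs_of_nonpos (by linarith)] at hd
        rw [Real.dist_eq, abs_of_nonpos (by linarith)]
        linarith
    intro y hy
    rcases le_total x y with hxy | hxy
    · rw [dist_comm]
      exact key x y hxy (by rwa [dist_comm])
    · exact key y x hxy hy
  · simp [hPA 0 h0]
  · simp [hPA 1 h1]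
  · rintro _ ⟨x, rfl⟩
    rw [← γ.extend_range]
    exact mem_range_self _
  · intro x y z hxz hzy hxy
    have hxz' : P x ≤ P z := hPm x z x.2.1 hxz
    have hzy' : P z ≤ P y := hPm z y z.2.1 hzy
    have hd := disjoint_of_minimal_isLoopErasure hA (hP x x.2.1).1 (hP y y.2.1).1 hxy
    rcases hxz'.lt_or_eq with h1 | h1
    · rcases hzy'.lt_or_eq with h2 | h2
      · exact (Set.disjoint_left.1 hd ⟨h1, h2⟩ (hP z z.2.1).1).elim
      · dsimp only
        rw [h2]
        exact hxy.symm
    · dsimp only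
      rw [h1]

theorem exists_monotone_separating {g : unitInterval → X} (hg : Continuous g)
    (hfib : ∀ x y z, x ≤ z → z ≤ y → g x = g y → g z = g x) :
    ∃ m : unitInterval → ℝ, Continuous m ∧ Monotone m ∧ ∀ x y, m x = m y ↔ g x = g y := by
  let G : ℝ → X := IccExtend zero_le_one g
  have hG : Continuous G := hg.Icc_extend'
  let d : ℚ → ℝ → ℝ → ℝ := fun q x s => min 1 (dist (G q) (G (q + s * (max x q - q))))
  let φ : ℚ → ℝ → ℝ := fun q x => sSup (d q x '' Icc 0 1)
  have hb : ∀ q x, BddAbove (d q x '' Icc 0 1) := fun q x =>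
    ⟨1, by rintro _ ⟨s, -, rfl⟩; exact min_le_left _ _⟩
  have hne : ∀ q x, (d q x '' Icc 0 1).Nonempty := fun q x => ⟨_, 0, by simp, rfl⟩
  have hd0 : ∀ q x s, 0 ≤ d q x s := fun q x s => le_min zero_le_one dist_nonneg
  have hle : ∀ (q : ℚ) (x : ℝ), ∀ t ∈ Icc (q : ℝ) (max x q), min 1 (dist (G q) (G t)) ≤ φ q x := by
    intro q x t ht
    refine le_csSup (hb q x) ?_
    rcases (ht.1.trans ht.2).lt_or_eq with h | h
    · refine ⟨(t - q) / (max x q - q), ⟨div_nonneg (by linarith [ht.1]) (by linarith),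
        (div_le_one (by linarith)).2 (by linarith [ht.2])⟩, ?_⟩
      simp only [d]
      rw [div_mul_cancel₀ _ (sub_pos.2 h).ne', add_sub_cancel]
    · refine ⟨0, by simp, ?_⟩
      have : t = q := le_antisymm (ht.2.trans h.symm.le) ht.1
      simp [d, this]
  have hle' : ∀ (q : ℚ) (x : ℝ) c, (∀ t ∈ Icc (q : ℝ) (max x q), min 1 (dist (G q) (G t)) ≤ c) →
      φ q x ≤ c := by
    intro q x c h
    refine csSup_le (hne q x) ?_
    rintro _ ⟨s, hs, rfl⟩
    have hq : (q : ℝ) ≤ max x q := le_max_right _ _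
    exact h _ ⟨by nlinarith [hs.1], by nlinarith [hs.2]⟩
  have hφm : ∀ q, Monotone (φ q) := fun q x y hxy => hle' q x _ fun t ht =>
    hle q y t ⟨ht.1, ht.2.trans (max_le_max_right _ hxy)⟩
  have hφ0 : ∀ q x, 0 ≤ φ q x := fun q x => Real.sSup_nonneg (by
    rintro _ ⟨s, -, rfl⟩; exact hd0 q x s)
  have hφ1 : ∀ q x, φ q x ≤ 1 := fun q x => hle' q x _ fun t _ => min_le_left _ _
  have hφc : ∀ q, Continuous (φ q) := fun q => by
    refine isCompact_Icc.continuous_sSup ?_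
    simp only [Function.HasUncurry.uncurry, d]
    fun_prop
  let w : ℕ → ℝ := fun n => (1 / 2) ^ n
  have hw : ∀ n, 0 < w n := fun n => by positivity
  obtain ⟨e, he⟩ := exists_surjective_nat ℚ
  let m : ℝ → ℝ := fun x => ∑' n, w n * φ (e n) x
  have hsum : ∀ x, Summable fun n => w n * φ (e n) x := fun x =>
    Summable.of_nonneg_of_le (fun n => mul_nonneg (hw n).le (hφ0 _ _))
      (fun n => mul_le_of_le_one_right (hw n).le (hφ1 _ _)) summable_geometric_two
  have hmc : Continuous m := by
    refine continuous_tsum (fun n => continuous_const.mul (hφc _)) summable_geometric_two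
      fun n x => ?_
    rw [Real.norm_eq_abs, abs_of_nonneg (mul_nonneg (hw n).le (hφ0 _ _))]
    exact mul_le_of_le_one_right (hw n).le (hφ1 _ _)
  have hmm : Monotone m := fun x y hxy => (hsum x).tsum_le_tsum
    (fun n => mul_le_mul_of_nonneg_left (hφm _ hxy) (hw n).le) (hsum y)
  have hGg : ∀ x : unitInterval, G x = g x := fun x => IccExtend_val _ _ _
  have key : ∀ x y : unitInterval, x ≤ y → (m x = m y ↔ g x = g y) := by
    intro x y hxy
    constructor
    · intro h
      by_contra hgxy
      have hlt : (x : ℝ) < y := lt_of_le_of_ne hxy fun h => hgxy (by rw [Subtype.ext h])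
      have hev : ∀ᶠ t in 𝓝 (x : ℝ), G t ≠ G y :=
        hG.continuousAt.eventually_ne (by rwa [hGg, hGg])
      obtain ⟨l, r, hlr, hlr'⟩ := mem_nhds_iff_exists_Ioo_subset.1 hev
      obtain ⟨q, hq1, hq2⟩ := exists_rat_btwn (lt_min hlt hlr.2)
      have hGq : G q ≠ G y := hlr' ⟨hlr.1.trans hq1, hq2.trans_le (min_le_right _ _)⟩
      have hqy : (q : ℝ) < y := hq2.trans_le (min_le_left _ _)
      obtain ⟨n, rfl⟩ := he q
      have h1 : φ (e n) x ≤ 0 := hle' _ _ _ fun t ht => by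
        rw [max_eq_right hq1.le, Icc_self, mem_singleton_iff] at ht
        simp [ht]
      have h2 : 0 < φ (e n) y := lt_of_lt_of_le (lt_min one_pos (dist_pos.2 hGq))
        (hle _ _ _ ⟨hqy.le, le_max_left _ _⟩)
      refine absurd h (ne_of_lt ?_)
      exact Summable.tsum_lt_tsum (i := n)
        (fun k => mul_le_mul_of_nonneg_left (hφm _ (Subtype.coe_le_coe.2 hxy)) (hw k).le)
        (mul_lt_mul_of_pos_left (h1.trans_lt h2) (hw n)) (hsum _) (hsum _)
    · intro h
      have hconst : ∀ t ∈ Icc (x : ℝ) y, G t = G x := by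
        intro t ht
        have htI : t ∈ Icc (0 : ℝ) 1 := ⟨x.2.1.trans ht.1, ht.2.trans y.2.2⟩
        have := hfib x y ⟨t, htI⟩ ht.1 ht.2 h
        rw [hGg x, ← this]
        exact IccExtend_of_mem _ _ htI
      refine tsum_congr fun n => ?_
      congr 1
      refine le_antisymm (hφm _ (Subtype.coe_le_coe.2 hxy)) (hle' _ _ _ fun t ht => ?_)
      rcases le_total (e n : ℝ) x with hq | hq
      · rw [max_eq_left (hq.trans (Subtype.coe_le_coe.2 hxy))] at ht
        rcases le_total t x with htx | htx
        · exact hle _ _ _ ⟨ht.1, htx.trans (le_max_left _ _)⟩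
        · rw [hconst t ⟨htx, ht.2⟩]
          exact hle _ _ _ ⟨hq, le_max_left _ _⟩
      · refine le_trans (le_of_eq ?_) (hφ0 _ _)
        rcases le_total (e n : ℝ) y with hqy | hqy
        · rw [max_eq_left hqy] at ht
          rw [hconst t ⟨hq.trans ht.1, ht.2⟩, hconst (e n) ⟨hq, hqy⟩]
          simp
        · rw [max_eq_right hqy, Icc_self, mem_singleton_iff] at ht
          simp [ht]
  refine ⟨fun x => m x, hmc.comp continuous_subtype_val, fun x y h => hmm h, fun x y => ?_⟩
  rcases le_total x y with h | h
  · exact key x y h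
  · rw [eq_comm, key y x h, eq_comm]

/-- Two distinct points joined by a path are joined by an arc in its range. -/
theorem exists_arc_of_path {a b : X} (γ : Path a b) (hab : a ≠ b) :
    ∃ α : unitInterval → X, Continuous α ∧ Function.Injective α ∧ α 0 = a ∧ α 1 = b ∧
      range α ⊆ range γ := by
  obtain ⟨g, hg, h0, h1, hr, hfib⟩ := exists_continuous_ordConnected_fibres γ
  obtain ⟨m, hm, hmm, hmg⟩ := exists_monotone_separating hg hfib
  have hlt : m 0 < m 1 := lt_of_le_of_ne (hmm zero_le_one) fun h => hab (by
    rw [← h0, ← h1, (hmg 0 1).1 h])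
  let μ : unitInterval → unitInterval := fun x => ⟨(m x - m 0) / (m 1 - m 0),
    div_nonneg (sub_nonneg.2 (hmm x.2.1)) (sub_pos.2 hlt).le,
    (div_le_one (sub_pos.2 hlt)).2 (sub_le_sub_right (hmm x.2.2) _)⟩
  have hμ : Continuous μ := by fun_prop
  have hμ0 : μ 0 = 0 := Subtype.ext (by simp [μ])
  have hμ1 : μ 1 = 1 := Subtype.ext (by simp [μ, div_self (sub_pos.2 hlt).ne'])
  have hμs : Function.Surjective μ := fun y => by
    have := isPreconnected_univ.intermediate_value (mem_univ 0) (mem_univ 1) hμ.continuousOn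
      (show y ∈ Icc (μ 0) (μ 1) by rw [hμ0, hμ1]; exact ⟨y.2.1, y.2.2⟩)
    obtain ⟨x, -, hx⟩ := this
    exact ⟨x, hx⟩
  have hμg : ∀ x y, μ x = μ y ↔ g x = g y := fun x y => by
    rw [← hmg, Subtype.ext_iff]
    simp only [μ]
    rw [div_left_inj' (sub_pos.2 hlt).ne', sub_left_inj]
  have hq : IsQuotientMap μ := IsQuotientMap.of_surjective_continuous hμs hμ
  let σ := Function.surjInv hμs
  have hσ : ∀ y, μ (σ y) = y := Function.surjInv_eq hμs
  have hαμ : (fun y => g (σ y)) ∘ μ = g := funext fun x => (hμg _ _).1 (hσ (μ x))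
  refine ⟨fun y => g (σ y), ?_, fun x y h => ?_, ?_, ?_, ?_⟩
  · rw [hq.continuous_iff, hαμ]
    exact hg
  · rw [← hσ x, ← hσ y]
    exact (hμg _ _).2 h
  · rw [← h0]
    exact (hμg _ _).1 ((hσ 0).trans hμ0.symm)
  · rw [← h1]
    exact (hμg _ _).1 ((hσ 1).trans hμ1.symm)
  · rintro _ ⟨y, rfl⟩
    exact hr (mem_range_self _)

end Arcs

section JordanRegions

theorem isEmbedding_domRestrict_of_continuousOn {X Y : Type*} [TopologicalSpace X]
    [TopologicalSpace Y] [T2Space Y] {s : Set X} {f : X → Y} (hs : IsCompact s)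
    (hf : ContinuousOn f s) (hi : InjOn f s) : IsEmbedding (s.domRestrict f) := by
  have : CompactSpace s := isCompact_iff_compactSpace.1 hs
  exact (Continuous.isClosedEmbedding (continuousOn_iff_continuous_domRestrict.1 hf)
    (injOn_iff_injective.1 hi)).isEmbedding

theorem hasContLogs_image_of_convex {X : Type*} [NormedAddCommGroup X] [NormedSpace ℝ X]
    {s : Set X} {f : X → Sphere2} (hs : IsCompact s) (hc : Convex ℝ s) (hne : s.Nonempty)
    (hf : ContinuousOn f s) (hi : InjOn f s) : HasContLogs (f '' s) := by
  have : ContractibleSpace s := hc.contractibleSpace hne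
  exact hasContLogs_image (isEmbedding_domRestrict_of_continuousOn hs hf hi)

theorem IsJordanRegion.exists_param {D : Set Sphere2} (hD : IsJordanRegion D) :
    ∃ f : EuclideanSpace ℝ (Fin 2) → Sphere2, ContinuousOn f (closedBall 0 1) ∧
      InjOn f (closedBall 0 1) ∧ f '' closedBall 0 1 = D ∧ f '' sphere 0 1 = frontier D := by
  obtain ⟨f, hf, h1, h2⟩ := hD
  exact ⟨f, continuousOn_iff_continuous_domRestrict.2 hf.continuous, injOn_iff_injective.2 hf.injective,
    h1, h2⟩

theorem IsJordanRegion.isClosed {D : Set Sphere2} (hD : IsJordanRegion D) : IsClosed D := by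
  obtain ⟨f, hf, -, rfl, -⟩ := hD.exists_param
  exact ((isCompact_closedBall _ _).image_of_continuousOn hf).isClosed

theorem IsJordanRegion.isPreconnected {D : Set Sphere2} (hD : IsJordanRegion D) :
    IsPreconnected D := by
  obtain ⟨f, hf, -, rfl, -⟩ := hD.exists_param
  exact (convex_closedBall _ _).isPreconnected.image f hf

theorem IsJordanRegion.hasContLogs {D : Set Sphere2} (hD : IsJordanRegion D) :
    HasContLogs D := by
  obtain ⟨f, hf, hi, rfl, -⟩ := hD.exists_param
  exact hasContLogs_image_of_convex (isCompact_closedBall _ _) (convex_closedBall _ _)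
    ⟨0, by simp⟩ hf hi

theorem IsJordanRegion.ne_univ {D : Set Sphere2} (hD : IsJordanRegion D) : D ≠ univ := by
  obtain ⟨f, -, -, -, h⟩ := hD.exists_param
  rintro rfl
  rw [frontier_univ, image_eq_empty] at h
  have := (NormedSpace.sphere_nonempty (x := (0 : EuclideanSpace ℝ (Fin 2))) (r := 1)).2
    zero_le_one
  exact this.ne_empty h

theorem IsJordanRegion.isTamePoint {D L : Set Sphere2} (hD : IsJordanRegion D)
    (hL : IsClosed L) {p : Sphere2} (hp : p ∈ frontier D) (hpL : p ∉ L) :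
    IsTamePoint 0 (D ∪ L) p := by
  obtain ⟨f, hf, hi, rfl, h⟩ := hD.exists_param
  rw [← h] at hp
  obtain ⟨u, hu, rfl⟩ := hp
  have huB : u ∈ closedBall (0 : EuclideanSpace ℝ (Fin 2)) 1 := sphere_subset_closedBall hu
  rw [mem_sphere_zero_iff_norm] at hu
  intro V hV huV
  have hnhds : V \ L ∈ 𝓝 (f u) := (hV.sdiff hL).mem_nhds ⟨huV, hpL⟩
  obtain ⟨ε, hε, hεV⟩ := Metric.mem_nhdsWithin_iff.1 (hf u huB hnhds)
  let φ : EuclideanSpace ℝ (Fin 2) →ₗ[ℝ] ℝ := (innerSL ℝ u).toLinearMap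
  have hφ : Continuous φ := (innerSL ℝ u).continuous
  have hφu : φ u = 1 := by simp [φ, hu]
  let t : ℝ := 1 - ε ^ 2 / 3
  have ht : t < 1 := by simp only [t]; linarith [pow_pos hε 2]
  let B := closedBall (0 : EuclideanSpace ℝ (Fin 2)) 1
  let C := B ∩ {x | t ≤ φ x}
  let C' := B ∩ {x | φ x ≤ t}
  have hC : IsCompact C := (isCompact_closedBall _ _).inter_right (isClosed_le continuous_const hφ)
  have hC' : IsCompact C' :=
    (isCompact_closedBall _ _).inter_right (isClosed_le hφ continuous_const)
  have hCV : f '' C ⊆ V \ L := by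
    rintro _ ⟨x, hx, rfl⟩
    refine hεV ⟨?_, hx.1⟩
    rw [mem_ball, dist_eq_norm]
    have h1 : ‖x‖ ≤ 1 := by simpa [B] using hx.1
    have h2 : t ≤ φ x := hx.2
    have h3 := norm_sub_sq_real x u
    rw [real_inner_comm, hu] at h3
    have h4 : φ x = inner ℝ u x := rfl
    have h5 : ‖x‖ ^ 2 ≤ 1 := pow_le_one₀ (norm_nonneg _) h1
    refine lt_of_pow_lt_pow_left₀ 2 hε.le ?_
    simp only [t] at h2
    nlinarith [pow_pos hε 2]
  refine ⟨f '' C, f '' C' ∪ L, (hC.image_of_continuousOn (hf.mono inter_subset_left)).isClosed,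
    (hC'.image_of_continuousOn (hf.mono inter_subset_left)).isClosed.union hL, ?_,
    hCV.trans sdiff_subset, ?_, ?_, fun _ => f '' (C ∩ C'), fun _ => ?_, ?_⟩
  · rw [← union_assoc, ← image_union, ← inter_union_distrib_left]
    congr 2
    exact inter_eq_left.2 fun x _ => le_total t (φ x)
  · rintro (⟨x, hx, hxu⟩ | h)
    · rw [hi hx.1 huB hxu] at hx
      exact (hφu ▸ hx.2 : (1 : ℝ) ≤ t).not_gt ht
    · exact hpL h
  · exact hasContLogs_image_of_convex hC
      ((convex_closedBall _ _).inter (convex_halfSpace_ge φ.isLinear t))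
      ⟨u, huB, show t ≤ φ u from hφu ▸ ht.le⟩ (hf.mono inter_subset_left)
      (hi.mono inter_subset_left)
  · refine IsPreconnected.image (Convex.isPreconnected ?_) f
      (hf.mono (inter_subset_left.trans inter_subset_left))
    exact ((convex_closedBall _ _).inter (convex_halfSpace_ge φ.isLinear t)).inter
      ((convex_closedBall _ _).inter (convex_halfSpace_le φ.isLinear t))
  · rw [iUnion_const, inter_union_distrib_left,
      (disjoint_sdiff_left.mono_left hCV).inter_eq, union_empty]
    exact (hi.image_inter inter_subset_left inter_subset_left).symm

end JordanRegions

section Stars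

theorem hasContLogs_union_biUnion {ι : Type*} {T : Set Sphere2} {C : ι → Set Sphere2}
    (hT : IsClosed T) (hTl : HasContLogs T) (s : Finset ι) (hC : ∀ i ∈ s, IsClosed (C i))
    (hCl : ∀ i ∈ s, HasContLogs (C i)) (hTC : ∀ i ∈ s, IsPreconnected (T ∩ C i))
    (hCC : ∀ i ∈ s, ∀ j ∈ s, i ≠ j → C i ∩ C j ⊆ T) : HasContLogs (T ∪ ⋃ i ∈ s, C i) := by
  classical
  induction s using Finset.induction_on with
  | empty => simpa using hTl
  | insert a s ha ih =>
    have ih := ih (fun i hi => hC i (Finset.mem_insert_of_mem hi))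
      (fun i hi => hCl i (Finset.mem_insert_of_mem hi))
      (fun i hi => hTC i (Finset.mem_insert_of_mem hi))
      fun i hi j hj => hCC i (Finset.mem_insert_of_mem hi) j (Finset.mem_insert_of_mem hj)
    have haa := Finset.mem_insert_self a s
    rw [Finset.set_biUnion_insert, union_comm (C a), ← union_assoc]
    refine ih.union (hCl a haa) (hT.union (s.finite_toSet.isClosed_biUnion fun i hi =>
      hC i (Finset.mem_insert_of_mem hi))) (hC a haa) ?_
    have : (T ∪ ⋃ i ∈ s, C i) ∩ C a = T ∩ C a := by
      refine Subset.antisymm ?_ (inter_subset_inter_left _ subset_union_left)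
      rintro x ⟨hx | hx, hxa⟩
      · exact ⟨hx, hxa⟩
      · obtain ⟨i, hi, hxi⟩ := mem_iUnion₂.1 hx
        exact ⟨hCC i (Finset.mem_insert_of_mem hi) a haa (fun h => ha (h ▸ hi)) ⟨hxi, hxa⟩, hxa⟩
    rw [this]
    exact hTC a haa

/-- Arcs `α i`, `i ∈ s`, issuing from `c` and otherwise pairwise disjoint. -/
structure IsArcStar {ι : Type*} (c : Sphere2) (α : ι → ℝ → Sphere2) (s : Finset ι) : Prop where
  continuous : ∀ i ∈ s, Continuous (α i)
  injOn : ∀ i ∈ s, InjOn (α i) (Icc 0 1)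
  zero : ∀ i ∈ s, α i 0 = c
  eq_zero : ∀ i ∈ s, ∀ j ∈ s, i ≠ j → ∀ x ∈ Icc (0 : ℝ) 1, ∀ y ∈ Icc (0 : ℝ) 1,
    α i x = α j y → x = 0

namespace IsArcStar

variable {ι : Type*} {c : Sphere2} {α : ι → ℝ → Sphere2} {s : Finset ι}

theorem isClosed (hα : IsArcStar c α s) {δ : ℝ} :
    IsClosed ({c} ∪ ⋃ i ∈ s, α i '' Icc 0 δ) :=
  isClosed_singleton.union (s.finite_toSet.isClosed_biUnion fun i hi =>
    (isCompact_Icc.image (hα.continuous i hi)).isClosed)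

theorem hasContLogs (hα : IsArcStar c α s) {δ : ℝ} (hδ : 0 ≤ δ) (hδ' : δ ≤ 1) :
    HasContLogs ({c} ∪ ⋃ i ∈ s, α i '' Icc 0 δ) := by
  refine hasContLogs_union_biUnion isClosed_singleton (hasContLogs_singleton c) s
    (fun i hi => (isCompact_Icc.image (hα.continuous i hi)).isClosed)
    (fun i hi => hasContLogs_image_of_convex isCompact_Icc (convex_Icc _ _)
      (nonempty_Icc.2 hδ) (hα.continuous i hi).continuousOn
      ((hα.injOn i hi).mono (Icc_subset_Icc_right hδ')))
    (fun i hi => (subsingleton_singleton.anti inter_subset_left).isPreconnected) ?_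
  rintro i hi j hj hij _ ⟨⟨x, hx, rfl⟩, ⟨y, hy, hxy⟩⟩
  rw [hα.eq_zero i hi j hj hij x (Icc_subset_Icc_right hδ' hx) y (Icc_subset_Icc_right hδ' hy)
    hxy.symm, hα.zero i hi]
  rfl

theorem isTamePoint {k : ℕ} {α : Fin k → ℝ → Sphere2} {s : Finset (Fin k)}
    (hα : IsArcStar c α s) {L : Set Sphere2} (hL : IsClosed L) (hcL : c ∉ L) :
    IsTamePoint k (({c} ∪ ⋃ i ∈ s, α i '' Icc 0 1) ∪ L) c := by
  intro V hV hcV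
  have hev : ∀ᶠ δ in 𝓝[>] (0 : ℝ), δ < 1 ∧ ∀ i ∈ s, α i '' Icc 0 δ ⊆ V \ L := by
    refine ((eventually_lt_nhds one_pos).filter_mono nhdsWithin_le_nhds).and ?_
    rw [Filter.eventually_all_finset]
    intro i hi
    have hn : α i ⁻¹' (V \ L) ∈ 𝓝 (0 : ℝ) := (hα.continuous i hi).continuousAt.preimage_mem_nhds
      ((hV.sdiff hL).mem_nhds (by rw [hα.zero i hi]; exact ⟨hcV, hcL⟩))
    obtain ⟨ε, hε, hεV⟩ := Metric.mem_nhds_iff.1 hn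
    filter_upwards [Ioo_mem_nhdsGT hε] with δ hδ
    rintro _ ⟨x, hx, rfl⟩
    refine hεV ?_
    rw [mem_ball, Real.dist_eq, sub_zero, abs_of_nonneg hx.1]
    exact hx.2.trans_lt hδ.2
  obtain ⟨δ, ⟨hδ1, hδV⟩, hδ0⟩ := (hev.and self_mem_nhdsWithin).exists
  replace hδ0 : 0 < δ := hδ0
  have hDV : ({c} ∪ ⋃ i ∈ s, α i '' Icc 0 δ) ⊆ V \ L :=
    union_subset (singleton_subset_iff.2 ⟨hcV, hcL⟩) (iUnion₂_subset hδV)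
  have hδI : Icc δ 1 ⊆ Icc (0 : ℝ) 1 := Icc_subset_Icc_left hδ0.le
  have hδI' : Icc 0 δ ⊆ Icc (0 : ℝ) 1 := Icc_subset_Icc_right hδ1.le
  have hc : c ∉ ⋃ i ∈ s, α i '' Icc δ 1 := by
    intro h
    obtain ⟨i, hi, x, hx, hxc⟩ := mem_iUnion₂.1 h
    have := hα.injOn i hi (hδI hx) (by simp) (hxc.trans (hα.zero i hi).symm)
    exact (hδ0.trans_le hx.1).ne' this
  refine ⟨_, (⋃ i ∈ s, α i '' Icc δ 1) ∪ L, hα.isClosed, ?_, ?_, hDV.trans sdiff_subset,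
    ?_, hα.hasContLogs hδ0.le hδ1.le,
    Fin.cases ∅ fun i => {x | i ∈ s ∧ x = α i δ}, ?_, ?_⟩
  · exact (s.finite_toSet.isClosed_biUnion fun i hi =>
      (isCompact_Icc.image (hα.continuous i hi)).isClosed).union hL
  · rw [← union_assoc, union_assoc {c}]
    simp_rw [← iUnion_union_distrib, ← image_union, Icc_union_Icc_eq_Icc hδ0.le hδ1.le]
  · rintro (h | h)
    exacts [hc h, hcL h]
  · intro j
    refine Fin.cases ?_ (fun i => ?_) j
    · exact isPreconnected_empty
    · refine Subsingleton.isPreconnected fun x hx y hy => ?_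
      exact hx.2.trans hy.2.symm
  · ext x
    simp only [mem_iUnion]
    constructor
    · rintro ⟨hx, hx' | hx'⟩
      · obtain ⟨j, hj, v, hv, rfl⟩ := mem_iUnion₂.1 hx'
        rcases hx with hx | hx
        · exact (hc (hx ▸ hx')).elim
        · obtain ⟨i, hi, u, hu, huv⟩ := mem_iUnion₂.1 hx
          obtain rfl : i = j := by
            by_contra hij
            exact (hδ0.trans_le hv.1).ne'
              (hα.eq_zero j hj i hi (Ne.symm hij) v (hδI hv) u (hδI' hu) huv.symm)
          obtain rfl := hα.injOn i hi (hδI' hu) (hδI hv) huv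
          refine ⟨i.succ, hi, ?_⟩
          rw [le_antisymm hu.2 hv.1]
      · exact ((hDV hx).2 hx').elim
    · rintro ⟨j, hj⟩
      revert hj
      refine Fin.cases (fun h => h.elim) (fun i hi => ?_) j
      obtain ⟨hi, rfl⟩ := hi
      exact ⟨Or.inr (mem_iUnion₂.2 ⟨i, hi, δ, ⟨hδ0.le, le_rfl⟩, rfl⟩),
        Or.inl (mem_iUnion₂.2 ⟨i, hi, δ, ⟨le_rfl, hδ1.le⟩, rfl⟩)⟩

end IsArcStar

end Stars

section CarpetStars

variable {D : ℕ → Set Sphere2}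

/-- A null sequence of disjoint Jordan regions with some members removed is a null family. -/
theorem isNullFamily_of_isJordanRegion (hJ : ∀ n, IsJordanRegion (D n))
    (hdisj : ∀ m n, m ≠ n → Disjoint (D m) (D n))
    (hnull : ∀ ε : ℝ, 0 < ε → {n : ℕ | ε < diam (D n)}.Finite) (P : ℕ → Prop) :
    IsNullFamily fun n => {x ∈ D n | P n} := by
  have h : ∀ n, {x ∈ D n | P n} = D n ∨ {x ∈ D n | P n} = ∅ := fun n => by
    by_cases hn : P n <;> simp [hn]
  refine ⟨fun n => ?_, fun n => ?_, fun n => ?_, fun n => ?_, fun {i j x} hi hj => ?_,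
    fun ε hε => ?_⟩
  · rcases h n with h | h <;> rw [h]
    exacts [(hJ n).isClosed, isClosed_empty]
  · rcases h n with h | h <;> rw [h]
    exacts [(hJ n).isPreconnected, isPreconnected_empty]
  · rcases h n with h | h <;> rw [h]
    exacts [(hJ n).hasContLogs, fun f _ _ => ⟨f, continuousOn_empty f, fun _ hx => hx.elim⟩]
  · rcases h n with h | h <;> rw [h]
    exacts [(hJ n).ne_univ, empty_ne_univ]
  · by_contra hij
    exact Set.disjoint_left.1 (hdisj i j hij) hi.1 hj.1
  · refine (hnull ε hε).subset fun n (hn : ε < diam _) => ?_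
    rcases h n with h | h <;> rw [h] at hn
    · exact hn
    · rw [diam_empty] at hn
      exact (hε.not_gt hn).elim

theorem IsArcStar.exists_insert (hJ : ∀ n, IsJordanRegion (D n))
    (hdisj : ∀ m n, m ≠ n → Disjoint (D m) (D n))
    (hnull : ∀ ε : ℝ, 0 < ε → {n : ℕ | ε < diam (D n)}.Finite)
    (hdense : Dense (⋃ n, D n)) {k : ℕ} {idx : Fin k → ℕ} (hidx : Function.Injective idx)
    {p : Fin k → Sphere2} (hp : ∀ j, p j ∈ frontier (D (idx j))) {c : Sphere2}
    (hc : ∀ n, c ∉ D n) {s : Finset (Fin k)} {α : Fin k → ℝ → Sphere2} (hα : IsArcStar c α s)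
    (hone : ∀ i ∈ s, α i 1 = p i) (hav : ∀ i ∈ s, ∀ t ∈ Icc (0 : ℝ) 1, ∀ n, α i t ∈ D n → t = 1)
    {a : Fin k} (ha : a ∉ s) :
    ∃ β : ℝ → Sphere2, Continuous β ∧ InjOn β (Icc 0 1) ∧ β 0 = c ∧ β 1 = p a ∧
      (∀ t ∈ Icc (0 : ℝ) 1, ∀ n, β t ∈ D n → t = 1) ∧
      ∀ t ∈ Icc (0 : ℝ) 1, ∀ i ∈ s, ∀ u ∈ Icc (0 : ℝ) 1, β t = α i u → t = 0 ∧ u = 0 := by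
  have hE := isNullFamily_of_isJordanRegion hJ hdisj hnull fun n => n ∉ range idx
  set E : ℕ → Set Sphere2 := fun n => {x ∈ D n | n ∉ range idx}
  set T : Set Sphere2 := {c} ∪ ⋃ i ∈ s, α i '' Icc 0 1
  have hTc : IsClosed T := hα.isClosed
  have hDeq : ∀ {m n x}, x ∈ D m → x ∈ D n → m = n := fun {m n x} hm hn => by
    by_contra h
    exact Set.disjoint_left.1 (hdisj m n h) hm hn
  have hpD : ∀ i, p i ∈ D (idx i) := fun i => (hJ _).isClosed.frontier_subset (hp i)
  have hTD : ∀ x ∈ T, ∀ n, x ∈ D n → ∃ i ∈ s, idx i = n ∧ x = p i := by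
    rintro x (rfl | hx) n hn
    · exact (hc n hn).elim
    · obtain ⟨i, hi, t, ht, rfl⟩ := mem_iUnion₂.1 hx
      obtain rfl := hav i hi t ht n hn
      rw [hone i hi] at hn ⊢
      exact ⟨i, hi, hDeq (hpD i) hn, rfl⟩
  have hcT : c ∈ T := Or.inl rfl
  have hpT : p a ∉ T := fun h => by
    obtain ⟨i, hi, hia, -⟩ := hTD _ h _ (hpD a)
    exact ha (hidx hia ▸ hi)
  have hcp : c ≠ p a := fun h => hpT (h ▸ hcT)
  have hLc : ∀ u : Finset (Fin k), IsClosed (⋃ l ∈ u, D (idx l)) := fun u =>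
    u.finite_toSet.isClosed_biUnion fun l _ => (hJ _).isClosed
  have hcL : c ∉ ⋃ l ∈ Finset.univ, D (idx l) := fun h => by
    obtain ⟨l, -, hl⟩ := mem_iUnion₂.1 h
    exact hc _ hl
  set K : Set Sphere2 := T ∪ ⋃ l ∈ Finset.univ, D (idx l)
  have hKc : IsClosed K := hTc.union (hLc _)
  have hDK : ∀ n x, x ∈ D n → x ∉ ⋃ i, E i → x ∈ K := fun n x hx hxE => by
    by_cases hn : n ∈ range idx
    · obtain ⟨l, rfl⟩ := hn
      exact Or.inr (mem_iUnion₂.2 ⟨l, Finset.mem_univ l, hx⟩)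
    · exact (hxE (mem_iUnion.2 ⟨n, hx, hn⟩)).elim
  have hKE : ∀ n, ∀ x ∈ E n, x ∉ K := by
    rintro n x ⟨hx, hn⟩ (h | h)
    · obtain ⟨i, -, hi, -⟩ := hTD x h n hx
      exact hn ⟨i, hi⟩
    · obtain ⟨l, -, hl⟩ := mem_iUnion₂.1 h
      exact hn ⟨l, hDeq hl hx⟩
  have hKl : HasContLogs K := by
    refine hasContLogs_union_biUnion hTc (hα.hasContLogs zero_le_one le_rfl) _
      (fun l _ => (hJ _).isClosed) (fun l _ => (hJ _).hasContLogs) (fun l _ => ?_) ?_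
    · refine Subsingleton.isPreconnected fun x hx y hy => ?_
      obtain ⟨i, -, hi, rfl⟩ := hTD x hx.1 _ hx.2
      obtain ⟨j, -, hj, rfl⟩ := hTD y hy.1 _ hy.2
      rw [hidx (hi.trans hj.symm)]
    · intro i _ j _ hij x hx
      exact (hij (hidx (hDeq hx.1 hx.2))).elim
  have hKp : IsPreconnected Kᶜ := hKl.isPreconnected_compl hKc
  have hccl : c ∈ closure Kᶜ := by
    rw [_root_.mem_closure_iff]
    intro V hV hcV
    obtain ⟨x, ⟨hxV, hxL⟩, hx⟩ := hdense.inter_open_nonempty _ (hV.sdiff (hLc Finset.univ))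
      ⟨c, hcV, hcL⟩
    obtain ⟨n, hn⟩ := mem_iUnion.1 hx
    refine ⟨x, hxV, hKE n x ⟨hn, ?_⟩⟩
    rintro ⟨l, rfl⟩
    exact hxL (mem_iUnion₂.2 ⟨l, Finset.mem_univ l, hn⟩)
  set L : Set Sphere2 := T ∪ ⋃ l ∈ Finset.univ.erase a, D (idx l)
  have hpL : p a ∉ L := by
    rintro (h | h)
    · exact hpT h
    · obtain ⟨l, hl, hlp⟩ := mem_iUnion₂.1 h
      exact Finset.ne_of_mem_erase hl (hidx (hDeq hlp (hpD a)))
  have hKL : D (idx a) ∪ L = K := by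
    rw [union_left_comm, ← Finset.set_biUnion_insert a (t := fun l => D (idx l)),
      Finset.insert_erase (Finset.mem_univ a)]
  have hpcl : p a ∈ closure Kᶜ := by
    rw [_root_.mem_closure_iff]
    intro V hV hpV
    have h := hp a
    rw [frontier_eq_closure_inter_closure] at h
    obtain ⟨x, hx, hxD⟩ := _root_.mem_closure_iff.1 h.2 _ (hV.sdiff (hTc.union (hLc _))) ⟨hpV, hpL⟩
    refine ⟨x, hx.1, ?_⟩
    rw [← hKL]
    rintro (h | h)
    exacts [hxD h, hx.2 h]
  have hpt : IsTamePoint 0 K (p a) := hKL ▸ (hJ _).isTamePoint (hTc.union (hLc _)) (hp a) hpL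
  obtain ⟨x, hx, hxE⟩ := hE.exists_mem_notMem hKc.isOpen_compl
    (fun i _ _ _ y hy => hKE i y hy) (closure_nonempty_iff.1 ⟨c, hccl⟩)
  have hxK : x ∈ Kᶜ \ ⋃ i, E i := ⟨hx, fun h => (mem_iUnion.1 h).elim hxE⟩
  have j₁ := hE.joinedIn_insert hKc hKE hKp (Or.inl hcT) hccl (hα.isTamePoint (hLc _) hcL) hxK
  have j₂ := hE.joinedIn_insert hKc hKE hKp (hKL ▸ Or.inl (hpD a)) hpcl hpt hxK
  set R : Set Sphere2 := {c, p a} ∪ (Kᶜ \ ⋃ i, E i)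
  have j : JoinedIn R c (p a) := by
    refine (j₁.symm.mono ?_).trans (j₂.mono ?_)
    · rintro y (rfl | hy)
      exacts [Or.inl (Or.inl rfl), Or.inr hy]
    · rintro y (rfl | hy)
      exacts [Or.inl (Or.inr rfl), Or.inr hy]
  obtain ⟨γ, hγ⟩ := j
  obtain ⟨β, hβ, hβi, hβ0, hβ1, hβγ⟩ := exists_arc_of_path γ hcp
  have hβR : ∀ t : unitInterval, β t ∈ R := fun t => by
    obtain ⟨u, hu⟩ := hβγ (mem_range_self t)
    exact hu ▸ hγ u
  have hval : ∀ t (ht : t ∈ Icc (0 : ℝ) 1), IccExtend zero_le_one β t = β ⟨t, ht⟩ :=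
    fun t ht => IccExtend_of_mem _ _ ht
  refine ⟨IccExtend zero_le_one β, hβ.Icc_extend', fun t ht u hu h => ?_, ?_, ?_, ?_, ?_⟩
  · rw [hval t ht, hval u hu] at h
    exact congrArg Subtype.val (hβi h)
  · rw [hval 0 (by simp)]
    exact hβ0
  · rw [hval 1 (by simp)]
    exact hβ1
  · intro t ht n hn
    rw [hval t ht] at hn
    rcases hβR ⟨t, ht⟩ with (h | h) | h
    · rw [h] at hn
      exact (hc n hn).elim
    · exact congrArg Subtype.val (hβi (h.trans hβ1.symm))
    · exact (h.1 (hDK n _ hn h.2)).elim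
  · intro t ht i hi u hu h
    rw [hval t ht] at h
    have hT' : β ⟨t, ht⟩ ∈ T := Or.inr (mem_iUnion₂.2 ⟨i, hi, u, hu, h.symm⟩)
    have hβc : β ⟨t, ht⟩ = c := by
      rcases hβR ⟨t, ht⟩ with (h | h) | h
      · exact h
      · exact (hpT (h ▸ hT')).elim
      · exact (h.1 (Or.inl hT')).elim
    refine ⟨congrArg Subtype.val (hβi (hβc.trans hβ0.symm)), hα.injOn i hi hu (by simp) ?_⟩
    rw [← h, hβc, hα.zero i hi]

theorem exists_isArcStar (hJ : ∀ n, IsJordanRegion (D n))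
    (hdisj : ∀ m n, m ≠ n → Disjoint (D m) (D n))
    (hnull : ∀ ε : ℝ, 0 < ε → {n : ℕ | ε < diam (D n)}.Finite)
    (hdense : Dense (⋃ n, D n)) {k : ℕ} {idx : Fin k → ℕ} (hidx : Function.Injective idx)
    {p : Fin k → Sphere2} (hp : ∀ j, p j ∈ frontier (D (idx j))) :
    ∃ (c : Sphere2) (α : Fin k → ℝ → Sphere2), IsArcStar c α Finset.univ ∧
      (∀ i, α i 1 = p i) ∧ ∀ i, ∀ t ∈ Icc (0 : ℝ) 1, ∀ n, α i t ∈ D n → t = 1 := by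
  obtain ⟨c, -, hc⟩ := (isNullFamily_of_isJordanRegion hJ hdisj hnull fun _ => True).exists_mem_notMem
    isOpen_univ (fun _ _ _ _ => subset_univ _) univ_nonempty
  have hc' : ∀ n, c ∉ D n := fun n hn => hc n ⟨hn, trivial⟩
  have key : ∀ s : Finset (Fin k), ∃ α : Fin k → ℝ → Sphere2, IsArcStar c α s ∧
      (∀ i ∈ s, α i 1 = p i) ∧ ∀ i ∈ s, ∀ t ∈ Icc (0 : ℝ) 1, ∀ n, α i t ∈ D n → t = 1 := by
    intro s
    induction s using Finset.induction_on with
    | empty => exact ⟨fun _ _ => c, ⟨by simp, by simp, by simp, by simp⟩, by simp, by simp⟩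
    | insert a s ha ih =>
      obtain ⟨α, hα, hone, hav⟩ := ih
      obtain ⟨β, hβ, hβi, hβ0, hβ1, hβD, hβα⟩ :=
        hα.exists_insert hJ hdisj hnull hdense hidx hp hc' hone hav ha
      have hne : ∀ i ∈ s, Function.update α a β i = α i := fun i hi =>
        Function.update_of_ne (fun h : i = a => ha (h ▸ hi)) _ _
      have haa : Function.update α a β a = β := Function.update_self _ _ _
      refine ⟨Function.update α a β, ⟨?_, ?_, ?_, ?_⟩, ?_, ?_⟩
      all_goals
        rw [Finset.forall_mem_insert, haa]
      · exact ⟨hβ, fun i hi => hne i hi ▸ hα.continuous i hi⟩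
      · exact ⟨hβi, fun i hi => hne i hi ▸ hα.injOn i hi⟩
      · exact ⟨hβ0, fun i hi => hne i hi ▸ hα.zero i hi⟩
      · constructor
        · rw [Finset.forall_mem_insert]
          refine ⟨fun h => (h rfl).elim, fun i hi _ x hx y hy hxy => ?_⟩
          rw [hne i hi] at hxy
          exact (hβα x hx i hi y hy hxy).1
        · intro i hi
          rw [Finset.forall_mem_insert, haa, hne i hi]
          refine ⟨fun _ x hx y hy hxy => (hβα y hy i hi x hx hxy.symm).2, fun j hj => ?_⟩
          rw [hne j hj]
          exact hα.eq_zero i hi j hj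
      · exact ⟨hβ1, fun i hi => hne i hi ▸ hone i hi⟩
      · exact ⟨hβD, fun i hi => hne i hi ▸ hav i hi⟩
  obtain ⟨α, hα, h1, h2⟩ := key Finset.univ
  exact ⟨c, α, hα, fun i => h1 i (Finset.mem_univ i), fun i => h2 i (Finset.mem_univ i)⟩

end CarpetStars

section StandardStar

theorem norm_starVertex (k j : ℕ) : ‖starVertex k j‖ = 1 := by
  simp [starVertex, pt2, EuclideanSpace.norm_eq, Fin.sum_univ_two]

theorem starVertex_injective (k : ℕ) :
    Function.Injective fun j : Fin k => starVertex k ((j : ℕ) + 1) := by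
  intro i j h
  have hk : (0 : ℝ) < k := by
    have := i.pos
    exact_mod_cast this
  have h0 := congrArg (fun v : EuclideanSpace ℝ (Fin 2) => v 0) h
  have h1 := congrArg (fun v : EuclideanSpace ℝ (Fin 2) => v 1) h
  simp only [starVertex, pt2, WithLp.equiv_symm_apply, Matrix.cons_val_zero,
    Matrix.cons_val_one] at h0 h1
  have h2 := Real.Angle.cos_sin_inj h0 h1
  obtain ⟨m, hm⟩ := Real.Angle.angle_eq_iff_two_pi_dvd_sub.1 h2
  have hπ := Real.pi_pos
  have h3 : ((i : ℕ) : ℝ) - (j : ℕ) = k * m := by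
    field_simp at hm
    push_cast at hm
    linarith
  have h4 : ((i : ℕ) : ℤ) - (j : ℕ) = k * m := by exact_mod_cast h3
  have h5 : m = 0 := by
    have hi := i.2
    have hj := j.2
    by_contra hm0
    rcases lt_or_gt_of_ne hm0 with h | h
    · have : (k : ℤ) * m ≤ k * (-1) := by gcongr; omega
      omega
    · have : (k : ℤ) * 1 ≤ k * m := by gcongr; omega
      omega
  rw [h5, mul_zero] at h4
  exact Fin.ext (by omega)

theorem starSet_eq_iUnion (k : ℕ) :
    starSet k = ⋃ j : Fin k, segment ℝ 0 (starVertex k ((j : ℕ) + 1)) := by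
  ext x
  simp only [starSet, mem_iUnion, Finset.mem_Icc]
  constructor
  · rintro ⟨j, ⟨h1, h2⟩, hx⟩
    exact ⟨⟨j - 1, by omega⟩, by rwa [show j - 1 + 1 = j by omega]⟩
  · rintro ⟨j, hx⟩
    exact ⟨j + 1, ⟨by omega, j.2⟩, hx⟩

theorem mem_segment_zero_iff {E : Type*} [NormedAddCommGroup E] [NormedSpace ℝ E] {q : E}
    (hq : ‖q‖ = 1) {x : E} : x ∈ segment ℝ 0 q ↔ ‖x‖ ≤ 1 ∧ x = ‖x‖ • q := by
  rw [segment_eq_image]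
  constructor
  · rintro ⟨t, ht, rfl⟩
    simp [norm_smul, hq, abs_of_nonneg ht.1, ht.2]
  · rintro ⟨h1, h2⟩
    exact ⟨‖x‖, ⟨norm_nonneg _, h1⟩, by simp [← h2]⟩

/-- Arcs issuing from a common point assemble to an embedding of the standard star. -/
theorem IsArcStar.exists_starSet {k : ℕ} {c : Sphere2} {α : Fin k → ℝ → Sphere2}
    (hα : IsArcStar c α Finset.univ) :
    ∃ h : EuclideanSpace ℝ (Fin 2) → Sphere2, IsEmbedding ((starSet k).domRestrict h) ∧
      (∀ j : Fin k, h (starVertex k ((j : ℕ) + 1)) = α j 1) ∧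
      h '' starSet k ⊆ ⋃ j, α j '' Icc 0 1 := by
  classical
  let q : Fin k → EuclideanSpace ℝ (Fin 2) := fun j => starVertex k ((j : ℕ) + 1)
  have hq : ∀ j, ‖q j‖ = 1 := fun j => norm_starVertex _ _
  have hmem : ∀ {j x}, x ∈ segment ℝ 0 (q j) ↔ ‖x‖ ≤ 1 ∧ x = ‖x‖ • q j :=
    fun {j x} => mem_segment_zero_iff (hq j)
  have hI : ∀ {j x}, x ∈ segment ℝ 0 (q j) → ‖x‖ ∈ Icc (0 : ℝ) 1 := fun hx =>
    ⟨norm_nonneg _, (hmem.1 hx).1⟩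
  let h : EuclideanSpace ℝ (Fin 2) → Sphere2 := fun x =>
    if hx : ∃ j, x ∈ segment ℝ 0 (q j) then α hx.choose ‖x‖ else c
  have hseg : ∀ j, ∀ x ∈ segment ℝ 0 (q j), h x = α j ‖x‖ := by
    intro j x hx
    have hx' : ∃ j, x ∈ segment ℝ 0 (q j) := ⟨j, hx⟩
    simp only [h, dif_pos hx']
    rcases eq_or_ne x 0 with rfl | hx0
    · rw [norm_zero, hα.zero _ (Finset.mem_univ _), hα.zero _ (Finset.mem_univ _)]
    · congr 1
      refine starVertex_injective k (smul_right_injective _ (norm_ne_zero_iff.2 hx0) ?_)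
      exact (hmem.1 hx'.choose_spec).2.symm.trans (hmem.1 hx).2
  have hstar : starSet k = ⋃ j, segment ℝ 0 (q j) := starSet_eq_iUnion k
  have hcomp : ∀ j, IsCompact (segment ℝ 0 (q j)) := fun j => by
    rw [segment_eq_image]
    exact isCompact_Icc.image (by fun_prop)
  refine ⟨h, ?_, fun j => ?_, ?_⟩
  · rw [hstar]
    refine isEmbedding_domRestrict_of_continuousOn (isCompact_iUnion hcomp) ?_ ?_
    · refine (locallyFinite_of_finite _).continuousOn_iUnion (fun j => (hcomp j).isClosed)
        fun j => ?_
      exact ((hα.continuous j (Finset.mem_univ j)).comp continuous_norm).continuousOn.congr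
        (hseg j)
    · intro x hx y hy hxy
      obtain ⟨i, hi⟩ := mem_iUnion.1 hx
      obtain ⟨j, hj⟩ := mem_iUnion.1 hy
      rw [hseg i x hi, hseg j y hj] at hxy
      rcases eq_or_ne i j with rfl | hij
      · have hn := hα.injOn i (Finset.mem_univ i) (hI hi) (hI hj) hxy
        rw [(hmem.1 hi).2, (hmem.1 hj).2, hn]
      · rw [norm_eq_zero.1 (hα.eq_zero i (Finset.mem_univ i) j (Finset.mem_univ j) hij _ (hI hi)
          _ (hI hj) hxy), norm_eq_zero.1 (hα.eq_zero j (Finset.mem_univ j) i (Finset.mem_univ i)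
          hij.symm _ (hI hj) _ (hI hi) hxy.symm)]
  · rw [hseg j _ (right_mem_segment ℝ 0 (q j)), norm_starVertex]
  · rw [hstar]
    rintro _ ⟨x, hx, rfl⟩
    obtain ⟨j, hj⟩ := mem_iUnion.1 hx
    rw [hseg j x hj]
    exact mem_iUnion.2 ⟨j, _, hI hj, rfl⟩

end StandardStar

theorem stmt0 (k : ℕ) (D : ℕ → Set Sphere2)
    (hJordan : ∀ n, IsJordanRegion (D n))
    (hdisj : ∀ m n, m ≠ n → Disjoint (D m) (D n))
    (hnull : ∀ ε : ℝ, 0 < ε → {n : ℕ | ε < Metric.diam (D n)}.Finite)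
    (hdense : Dense (⋃ n, D n))
    (S : Set Sphere2) (hS : S = (⋃ n, interior (D n))ᶜ)
    (idx : Fin k → ℕ) (hidx : Function.Injective idx)
    (p : Fin k → Sphere2) (hp : ∀ j, p j ∈ frontier (D (idx j))) :
    ∃ h : EuclideanSpace ℝ (Fin 2) → Sphere2,
      Topology.IsEmbedding ((starSet k).restrict h) ∧
      h '' starSet k ⊆ S ∧
      (∀ j : Fin k, h (starVertex k ((j : ℕ) + 1)) = p j) ∧
      h '' starSet k ∩ (⋃ n, frontier (D n)) = Set.range p := by
  obtain ⟨c, α, hα, hone, hav⟩ := exists_isArcStar hJordan hdisj hnull hdense hidx hp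
  obtain ⟨h, hh, hv, hr⟩ := hα.exists_starSet
  have key : ∀ x ∈ h '' starSet k, ∀ n, x ∈ D n → ∃ j, x = p j := by
    intro x hx n hn
    obtain ⟨j, t, ht, rfl⟩ := mem_iUnion.1 (hr hx)
    rw [hav j t ht n hn]
    exact ⟨j, hone j⟩
  refine ⟨h, hh, ?_, fun j => (hv j).trans (hone j), ?_⟩
  · rw [hS]
    intro x hx hxD
    obtain ⟨n, hn⟩ := mem_iUnion.1 hxD
    obtain ⟨j, rfl⟩ := key x hx n (interior_subset hn)
    have hj := hp j
    by_cases hnj : n = idx j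
    · subst hnj
      exact hj.2 hn
    · exact Set.disjoint_left.1 (hdisj _ _ hnj) (interior_subset hn)
        ((hJordan _).isClosed.frontier_subset hj)
  · refine Subset.antisymm ?_ ?_
    · rintro x ⟨hx, hxD⟩
      obtain ⟨n, hn⟩ := mem_iUnion.1 hxD
      obtain ⟨j, rfl⟩ := key x hx n ((hJordan n).isClosed.frontier_subset hn)
      exact mem_range_self j
    · rintro _ ⟨j, rfl⟩
      refine ⟨⟨_, ?_, (hv j).trans (hone j)⟩, mem_iUnion.2 ⟨_, hp j⟩⟩
      rw [starSet_eq_iUnion]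
      exact mem_iUnion.2 ⟨j, right_mem_segment ℝ _ _⟩
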